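/- arXiv:2502.13709 — 7 statements merged into one kernel-verified Lean document; each statement's English description precedes it below -/
import Mathlib

section
/- Let e_1, …, e_n be pairwise orthogonal idempotents of A with e_1 + … + e_n = 1. Let M and N be finite-dimensional A-modules, and let f, g : M → N be A-module homomorphisms with rank(f) = rank(g) = r(M,N). Then dim_K(e_i · Im(f)) = dim_K(e_i · Im(g)) for every i with 1 ≤ i ≤ n. -/
/-- The rank of an `A`-linear map between modules over a `K`-algebra `A`:
the `K`-dimension of its image. -/
noncomputable def rk (K : Type*) [Field K] {A : Type*} [Ring A] [Algebra K A]
    {M N : Type*} [AddCommGroup M] [Module A M]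
    [AddCommGroup N] [Module A N] [Module K N] [IsScalarTower K A N]
    (f : M →ₗ[A] N) : ℕ :=
  Module.finrank K ((LinearMap.range f).restrictScalars K)

/-- `rmax K A M N` is `r(M,N)`, the maximal rank of an `A`-linear map `M → N`. -/
noncomputable def rmax (K : Type*) [Field K] (A : Type*) [Ring A] [Algebra K A]
    (M N : Type*) [AddCommGroup M] [Module A M]
    [AddCommGroup N] [Module A N] [Module K N] [IsScalarTower K A N] : ℕ :=
  sSup {n : ℕ | ∃ f : M →ₗ[A] N, rk K f = n}

/-- For an element `a : A` and an `A`-submodule `U` of `N`, the `K`-subspace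
`a • U = {a • u : u ∈ U}` of `N`. -/
noncomputable def esub (K : Type*) [Field K] {A N : Type*} [Ring A] [Algebra K A]
    [AddCommGroup N] [Module A N] [Module K N] [IsScalarTower K A N]
    (a : A) (U : Submodule A N) : Submodule K N :=
  Submodule.span K {x : N | ∃ u ∈ U, a • u = x}

section

variable {K A M N : Type*} [Field K] [Ring A] [Algebra K A]
  [AddCommGroup M] [Module A M]
  [AddCommGroup N] [Module A N] [Module K N] [IsScalarTower K A N]

theorem esub_eq_map (a : A) (U : Submodule A N) :
    esub K a U = (U.restrictScalars K).map (Algebra.lsmul K K N a) := by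
  refine le_antisymm (Submodule.span_le.2 ?_) ?_
  · rintro x ⟨u, hu, rfl⟩
    exact ⟨u, hu, rfl⟩
  · rintro x ⟨u, hu, rfl⟩
    exact Submodule.subset_span ⟨u, hu, rfl⟩

theorem mem_esub {a : A} {U : Submodule A N} {x : N} :
    x ∈ esub K a U ↔ ∃ u ∈ U, a • u = x := by
  rw [esub_eq_map]
  exact Iff.rfl

theorem esub_range_eq_range [Module K M] [IsScalarTower K A M] (a : A) (f : M →ₗ[A] N) :
    esub K a (LinearMap.range f) =
      LinearMap.range (Algebra.lsmul K K N a ∘ₗ f.restrictScalars K) := by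
  ext x
  simp [mem_esub]

/-- A complete family of orthogonal idempotents decomposes the dimension of a submodule. -/
theorem finrank_eq_sum_finrank_esub [FiniteDimensional K N] {ι : Type*} [Fintype ι]
    {e : ι → A} (hidem : ∀ i, IsIdempotentElem (e i))
    (horth : ∀ i j, i ≠ j → e i * e j = 0) (hsum : ∑ i, e i = 1) (U : Submodule A N) :
    Module.finrank K (U.restrictScalars K) = ∑ i, Module.finrank K (esub K (e i) U) := by
  classical
  let φ : U.restrictScalars K →ₗ[K] (∀ i, esub K (e i) U) :=
    LinearMap.pi fun i =>
      ((Algebra.lsmul K K N (e i)).domRestrict (U.restrictScalars K)).codRestrict _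
        fun u => mem_esub.2 ⟨u, u.2, rfl⟩
  have hφ (u : U.restrictScalars K) (i : ι) : (φ u i : N) = e i • (u : N) := rfl
  have hinj : Function.Injective φ := by
    refine (injective_iff_map_eq_zero φ).2 fun u hu => Subtype.ext ?_
    have h (i : ι) : e i • (u : N) = 0 := by rw [← hφ, hu]; rfl
    rw [← one_smul A (u : N), ← hsum, Finset.sum_smul]
    exact Finset.sum_eq_zero fun i _ => h i
  have hsurj : Function.Surjective φ := by
    intro w
    choose u hu hw using fun i => mem_esub.1 (w i).2
    refine ⟨⟨∑ i, e i • u i, U.sum_mem fun i _ => U.smul_mem _ (hu i)⟩, ?_⟩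
    funext j
    refine Subtype.ext ?_
    rw [hφ, ← hw j]
    simp only [Finset.smul_sum, smul_smul]
    rw [Finset.sum_eq_single j (fun i _ hij => by rw [horth j i hij.symm, zero_smul])
      (by simp), (hidem j).eq]
  rw [(LinearEquiv.ofBijective φ ⟨hinj, hsurj⟩).finrank_eq, Module.finrank_pi_fintype]

theorem rk_le_rmax [FiniteDimensional K N] (f : M →ₗ[A] N) : rk K f ≤ rmax K A M N := by
  refine le_csSup ⟨Module.finrank K N, ?_⟩ ⟨f, rfl⟩
  rintro _ ⟨h, rfl⟩
  exact Submodule.finrank_le _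

end

section

variable {K V W : Type*} [Field K] [AddCommGroup V] [Module K V] [AddCommGroup W] [Module K W]
  [FiniteDimensional K W]

/-- Lower semicontinuity of the rank along a line. -/
theorem eventually_finrank_range_le_add_smul (F G : V →ₗ[K] W) :
    ∀ᶠ t : K in Filter.cofinite,
      Module.finrank K (LinearMap.range G) ≤ Module.finrank K (LinearMap.range (F + t • G)) := by
  obtain ⟨p, hp⟩ := G.rangeRestrict.exists_rightInverse_of_surjective G.range_rangeRestrict
  obtain ⟨q, hq⟩ :=
    (LinearMap.range G).subtype.exists_leftInverse_of_injective (Submodule.ker_subtype _)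
  let B : Module.End K (LinearMap.range G) := -(q ∘ₗ F ∘ₗ p)
  have hB : ∀ᶠ t : K in Filter.cofinite, t ∉ spectrum K B :=
    (Module.End.finite_spectrum B).compl_mem_cofinite
  filter_upwards [hB] with t ht
  have hu : IsUnit (algebraMap K (Module.End K (LinearMap.range G)) t - B) := by
    simpa [spectrum.mem_iff] using ht
  have hqGp (x : LinearMap.range G) : q (G (p x)) = x := by
    have h₁ : G (p x) = (x : W) := congrArg Subtype.val (LinearMap.congr_fun hp x)
    rw [h₁]
    exact LinearMap.congr_fun hq x
  have hsurj := ((Module.End.isUnit_iff _).1 hu).2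
  have htop : (LinearMap.range (F + t • G)).map q = ⊤ := by
    refine eq_top_iff.2 fun y _ => ?_
    obtain ⟨x, rfl⟩ := hsurj y
    refine ⟨(F + t • G) (p x), ⟨p x, rfl⟩, ?_⟩
    simp [B, hqGp, Module.algebraMap_end_apply, add_comm]
  rw [← finrank_top K (LinearMap.range G), ← htop]
  exact Submodule.finrank_map_le _ _

/-- For all but finitely many `t`, the rank of `F + t • G` is at least the ranks of `F`
and of `G`. -/
theorem eventually_finrank_range_max_le_add_smul (F G : V →ₗ[K] W) :
    ∀ᶠ t : K in Filter.cofinite,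
      Module.finrank K (LinearMap.range F) ≤ Module.finrank K (LinearMap.range (F + t • G)) ∧
      Module.finrank K (LinearMap.range G) ≤ Module.finrank K (LinearMap.range (F + t • G)) := by
  have h₀ : ∀ᶠ t : K in Filter.cofinite, t ≠ 0 :=
    (Set.finite_singleton (0 : K)).compl_mem_cofinite
  have h₁ := (inv_injective (G := K)).tendsto_cofinite.eventually
    (eventually_finrank_range_le_add_smul G F)
  filter_upwards [h₀, h₁, eventually_finrank_range_le_add_smul F G] with t ht hF hG
  refine ⟨?_, hG⟩
  have h : F + t • G = t • (G + t⁻¹ • F) := by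
    rw [smul_add, smul_smul, mul_inv_cancel₀ ht, one_smul, add_comm]
  rwa [h, LinearMap.range_smul _ _ ht]

end

section

variable {K A M N : Type*} [Field K] [Infinite K] [Ring A] [Algebra K A]
  [AddCommGroup M] [Module A M] [Module K M] [IsScalarTower K A M]
  [AddCommGroup N] [Module A N] [Module K N] [IsScalarTower K A N] [FiniteDimensional K N]

/-- Over an infinite field, some homomorphism `h : M → N` satisfies
`dim (e i • range f), dim (e i • range g) ≤ dim (e i • range h)` for all `i`. -/
theorem exists_finrank_esub_range_max_le {ι : Type*} [Finite ι] (e : ι → A) (f g : M →ₗ[A] N) :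
    ∃ h : M →ₗ[A] N, ∀ i,
      Module.finrank K (esub K (e i) (LinearMap.range f)) ≤
        Module.finrank K (esub K (e i) (LinearMap.range h)) ∧
      Module.finrank K (esub K (e i) (LinearMap.range g)) ≤
        Module.finrank K (esub K (e i) (LinearMap.range h)) := by
  have hev := Filter.eventually_all.2 fun i => eventually_finrank_range_max_le_add_smul
    (Algebra.lsmul K K N (e i) ∘ₗ f.restrictScalars K)
    (Algebra.lsmul K K N (e i) ∘ₗ g.restrictScalars K)
  obtain ⟨t, ht⟩ := hev.exists
  refine ⟨f + t • g, fun i => ?_⟩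
  have h : Algebra.lsmul K K N (e i) ∘ₗ (f + t • g).restrictScalars K =
      Algebra.lsmul K K N (e i) ∘ₗ f.restrictScalars K +
        t • (Algebra.lsmul K K N (e i) ∘ₗ g.restrictScalars K) := by
    ext x
    simp [smul_comm (e i) t]
  rw [esub_range_eq_range, esub_range_eq_range, esub_range_eq_range, h]
  exact ht i

end

theorem stmt0 {K A : Type*} [Field K] [IsAlgClosed K] [Ring A] [Algebra K A]
    [FiniteDimensional K A]
    {n : ℕ} (e : Fin n → A)
    (hidem : ∀ i, IsIdempotentElem (e i))
    (horth : ∀ i j, i ≠ j → e i * e j = 0)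
    (hsum : ∑ i, e i = 1)
    {M N : Type*}
    [AddCommGroup M] [Module A M] [Module K M] [IsScalarTower K A M] [FiniteDimensional K M]
    [AddCommGroup N] [Module A N] [Module K N] [IsScalarTower K A N] [FiniteDimensional K N]
    (f g : M →ₗ[A] N)
    (hf : rk K f = rmax K A M N) (hg : rk K g = rmax K A M N)
    (i : Fin n) :
    Module.finrank K (esub K (e i) (LinearMap.range f)) =
      Module.finrank K (esub K (e i) (LinearMap.range g)) := by
  have hdec (h : M →ₗ[A] N) :
      rk K h = ∑ j, Module.finrank K (esub K (e j) (LinearMap.range h)) :=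
    finrank_eq_sum_finrank_esub hidem horth hsum _
  have := IsAlgClosed.instInfinite (K := K)
  obtain ⟨h, hh⟩ := exists_finrank_esub_range_max_le (K := K) e f g
  have hle : rk K h ≤ rmax K A M N := rk_le_rmax h
  have key (k : M →ₗ[A] N) (hk : rk K k = rmax K A M N)
      (hkh : ∀ j, Module.finrank K (esub K (e j) (LinearMap.range k)) ≤
        Module.finrank K (esub K (e j) (LinearMap.range h))) :
      Module.finrank K (esub K (e i) (LinearMap.range k)) =
        Module.finrank K (esub K (e i) (LinearMap.range h)) := by
    refine (Finset.sum_eq_sum_iff_of_le fun j _ => hkh j).1 ?_ i (Finset.mem_univ i)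
    refine le_antisymm (Finset.sum_le_sum fun j _ => hkh j) ?_
    rwa [← hdec, ← hdec, hk]
  exact (key f hf fun j => (hh j).1).trans (key g hg fun j => (hh j).2).symm
end

section
/- Let S be a simple projective A-module, let P and M be finite-dimensional A-modules, and let f : P → M be an A-module homomorphism such that no nonzero direct summand of P is contained in Ker(f). Then Ker(f) ⊆ Ker(g) for every A-module homomorphism g : P → S. -/
/-- `U` is a direct summand of `P`: it has a complementary submodule. -/
def IsDirectSummand {A P : Type*} [Ring A] [AddCommGroup P] [Module A P]
    (U : Submodule A P) : Prop :=
  ∃ V : Submodule A P, IsCompl U V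

theorem stmt2 {K A : Type*} [Field K] [IsAlgClosed K] [Ring A] [Algebra K A]
    [FiniteDimensional K A]
    {S : Type*} [AddCommGroup S] [Module A S] [Module K S] [IsScalarTower K A S]
    [FiniteDimensional K S]
    (hSsimple : IsSimpleModule A S) (hSproj : Module.Projective A S)
    {P M : Type*}
    [AddCommGroup P] [Module A P] [Module K P] [IsScalarTower K A P] [FiniteDimensional K P]
    [AddCommGroup M] [Module A M] [Module K M] [IsScalarTower K A M] [FiniteDimensional K M]
    (f : P →ₗ[A] M)
    (hker : ∀ U : Submodule A P, IsDirectSummand U → U ≤ LinearMap.ker f → U = ⊥)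
    (g : P →ₗ[A] S) :
    LinearMap.ker f ≤ LinearMap.ker g := by
  rcases (g ∘ₗ (LinearMap.ker f).subtype).surjective_or_eq_zero with hsurj | hzero
  · obtain ⟨s, hs⟩ := LinearMap.exists_rightInverse_of_surjective
      (g ∘ₗ (LinearMap.ker f).subtype) (LinearMap.range_eq_top.2 hsurj)
    have hgt (x : S) : g (s x : P) = x := LinearMap.congr_fun hs x
    have hrange : LinearMap.range ((LinearMap.ker f).subtype ∘ₗ s) = ⊥ := by
      refine hker _ ⟨LinearMap.ker g, ?_⟩ ?_
      · rw [isCompl_iff, Submodule.disjoint_def, Submodule.codisjoint_iff_exists_add_eq]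
        refine ⟨?_, fun z => ⟨s (g z), z - s (g z), ⟨g z, rfl⟩, ?_, by simp⟩⟩
        · rintro _ ⟨y, rfl⟩ hy
          have hy' : y = 0 := (hgt y).symm.trans hy
          simp [hy']
        · simp [hgt]
      · rintro _ ⟨y, rfl⟩
        exact (s y).2
    have := hSsimple.nontrivial
    obtain ⟨x, hx⟩ := exists_ne (0 : S)
    have htx : (s x : P) = 0 := (Submodule.eq_bot_iff _).1 hrange _ ⟨x, rfl⟩
    exact absurd (by rw [← hgt x, htx, map_zero]) hx
  · exact fun x hx => LinearMap.congr_fun hzero ⟨x, hx⟩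
end

section
/- Let A be a basic finite-dimensional algebra over an algebraically closed field K. Then the following are equivalent: (i) A is isomorphic as a K-algebra to a finite product A_1 × … × A_t in which every factor A_i is a local ring; (ii) every τ-rigid finite-dimensional A-module is projective, where a finite-dimensional A-module M is called τ-rigid if Ext^1_A(M, N) = 0 for every A-module N that is a quotient of a finite direct sum of copies of M. -/
/-- `Ext¹_A(M,N) = 0`, stated elementarily: every short exact sequence
`0 → N → E → M → 0` of `A`-modules splits. -/
def ExtOneVanishes (A : Type) [Ring A] (M : Type) [AddCommGroup M] [Module A M]
    (N : Type) [AddCommGroup N] [Module A N] : Prop :=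
  ∀ (E : Type) [AddCommGroup E] [Module A E] (ι : N →ₗ[A] E) (ρ : E →ₗ[A] M),
    Function.Injective ι → Function.Surjective ρ → LinearMap.range ι = LinearMap.ker ρ →
    ∃ σ : M →ₗ[A] E, ρ.comp σ = LinearMap.id

/-- `M` is τ-rigid: `Ext¹_A(M,N) = 0` for every `A`-module `N` which is a quotient of a
finite direct sum of copies of `M`. -/
def TauRigid (A : Type) [Ring A] (M : Type) [AddCommGroup M] [Module A M] : Prop :=
  ∀ (N : Type) [AddCommGroup N] [Module A N],
    (∃ (k : ℕ) (φ : (Fin k → M) →ₗ[A] N), Function.Surjective φ) →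
    ExtOneVanishes A M N

/-- A decomposition of the `K`-algebra `A` as a finite product of local `K`-algebras. -/
structure LocalDecomp (K : Type) [Field K] (A : Type) [Ring A] [Algebra K A] : Type 1 where
  t : ℕ
  F : Fin t → Type
  [ringF : ∀ i, Ring (F i)]
  [algF : ∀ i, Algebra K (F i)]
  localF : ∀ i, IsLocalRing (F i)
  iso : A ≃ₐ[K] ((i : Fin t) → F i)

/-- If every extension of `M` by a simple module splits, then a surjection onto `M` with
Noetherian domain and nonzero kernel restricts to a surjection from a proper submodule. -/
theorem exists_lt_top_map_eq_top (A : Type) [Ring A] (M : Type) [AddCommGroup M] [Module A M]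
    (h : ∀ (S : Type) [AddCommGroup S] [Module A S] [IsSimpleModule A S], ExtOneVanishes A M S)
    {E : Type} [AddCommGroup E] [Module A E] [IsNoetherian A E] (r : E →ₗ[A] M)
    (hr : Function.Surjective r) (hne : LinearMap.ker r ≠ ⊥) :
    ∃ C : Submodule A E, C < ⊤ ∧ C.map r = ⊤ := by
  obtain ⟨L, -, hL⟩ := exists_le_covBy_of_lt (bot_lt_iff_ne_bot.mpr hne)
  have : IsSimpleModule A (LinearMap.ker r ⧸ L.submoduleOf (LinearMap.ker r)) :=
    (covBy_iff_quot_is_simple hL.le).mp hL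
  have hker : LinearMap.ker (L.mkQ ∘ₗ (LinearMap.ker r).subtype) =
      L.submoduleOf (LinearMap.ker r) := by
    rw [LinearMap.ker_comp, Submodule.ker_mkQ, Submodule.submoduleOf]
  obtain ⟨σ, hσ⟩ := h (LinearMap.ker r ⧸ L.submoduleOf (LinearMap.ker r)) (E ⧸ L)
    (Submodule.liftQ _ (L.mkQ ∘ₗ (LinearMap.ker r).subtype) hker.ge) (L.liftQ r hL.le)
    (LinearMap.ker_eq_bot.mp (Submodule.ker_liftQ_eq_bot _ _ _ hker.le))
    (by
      rw [← LinearMap.range_eq_top, Submodule.range_liftQ]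
      exact LinearMap.range_eq_top.mpr hr)
    (by
      rw [Submodule.ker_liftQ, Submodule.range_liftQ, LinearMap.range_comp, Submodule.range_subtype])
  have hσ' (m : M) : L.liftQ r hL.le (σ m) = m := LinearMap.congr_fun hσ m
  refine ⟨(LinearMap.range σ).comap L.mkQ, lt_top_iff_ne_top.mpr fun heq => ?_, ?_⟩
  · refine hL.lt.not_ge fun x hx => ?_
    obtain ⟨m, hm⟩ : x ∈ (LinearMap.range σ).comap L.mkQ := heq ▸ Submodule.mem_top
    have h1 := hσ' m
    rw [hm] at h1
    have h2 : r x = m := h1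
    rw [← Submodule.Quotient.mk_eq_zero, ← Submodule.mkQ_apply, ← hm, ← h2,
      LinearMap.mem_ker.mp hx, map_zero]
  · rw [eq_top_iff]
    intro m _
    obtain ⟨c, hc⟩ := L.mkQ_surjective (σ m)
    refine ⟨c, ⟨m, hc.symm⟩, ?_⟩
    have := hσ' m
    rwa [← hc] at this

/-- If every extension of a finitely generated module `M` over an Artinian ring by a simple module
splits, then `M` is projective. -/
theorem projective_of_extOneVanishes_of_isSimpleModule (A : Type) [Ring A] [IsArtinianRing A]
    (M : Type) [AddCommGroup M] [Module A M] [Module.Finite A M]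
    (h : ∀ (S : Type) [AddCommGroup S] [Module A S] [IsSimpleModule A S], ExtOneVanishes A M S) :
    Module.Projective A M := by
  obtain ⟨n, ρ, hρ⟩ := Module.Finite.exists_fin' A M
  obtain ⟨C, hC, hmin⟩ := WellFounded.has_min (wellFounded_lt (α := Submodule A (Fin n → A)))
    {C | C.map ρ = ⊤} ⟨⊤, by simpa [LinearMap.range_eq_top] using hρ⟩
  obtain ⟨r, hrρ⟩ : ∃ r : C →ₗ[A] M, ∀ c, r c = ρ c := ⟨ρ.domRestrict C, fun _ => rfl⟩
  have hr : Function.Surjective r := fun m => by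
    obtain ⟨c, hc, rfl⟩ : m ∈ C.map ρ := hC ▸ Submodule.mem_top
    exact ⟨⟨c, hc⟩, hrρ _⟩
  have hker : LinearMap.ker r = ⊥ := by
    by_contra hne
    obtain ⟨D, hD, hDr⟩ := exists_lt_top_map_eq_top A M h r hr hne
    refine hmin (D.map C.subtype) (?_ : Submodule.map ρ _ = ⊤) ?_
    · rw [eq_top_iff, ← hDr]
      rintro _ ⟨c, hc, rfl⟩
      exact ⟨c, ⟨c, hc, rfl⟩, (hrρ c).symm⟩
    · have := Submodule.map_strictMono_of_injective C.subtype_injective hD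
      rwa [Submodule.map_subtype_top] at this
  let s := LinearEquiv.ofBijective r ⟨LinearMap.ker_eq_bot.mp hker, hr⟩
  refine Module.Projective.of_split (C.subtype ∘ₗ s.symm.toLinearMap) ρ ?_
  ext m
  exact (hrρ _).symm.trans (s.apply_symm_apply m)

/-- A maximal left ideal of a ring which does not contain `e` is unique, if the quotient by the
annihilator of `e` is local. -/
theorem Ideal.IsMaximal.eq_of_notMem_of_isLocalRing {A F : Type*} [Ring A] [Ring F]
    [IsLocalRing F] (p : A →+* F) (hp : Function.Surjective p) {e : A}
    (he : ∀ x, p x = 0 → e * x = 0) {m n : Ideal A} (hm : m.IsMaximal) (hn : n.IsMaximal)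
    (hem : e ∉ m) (hen : e ∉ n) : m = n := by
  have key (I : Ideal A) (x : A) (hx : x ∈ I) (hu : IsUnit (p x)) : e ∈ I := by
    obtain ⟨y, hy⟩ := hp ((hu.unit⁻¹ : Fˣ) : F)
    have h0 := he (y * x - 1) (by rw [map_sub, map_mul, hy, IsUnit.val_inv_mul, map_one, sub_self])
    rw [mul_sub, mul_one, sub_eq_zero] at h0
    rw [← h0, ← mul_assoc]
    exact I.mul_mem_left _ hx
  by_contra hne
  have hsup := hm.coprime_of_ne hn hne
  obtain ⟨a, ha, b, hb, hab⟩ := Submodule.mem_sup.mp (hsup ▸ Submodule.mem_top : (1 : A) ∈ m ⊔ n)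
  rcases IsLocalRing.isUnit_or_isUnit_of_add_one
    (show p a + p b = 1 by rw [← map_add, hab, map_one]) with h | h
  · exact hem (key m a ha h)
  · exact hen (key n b hb h)

/-- A central element not annihilating `A ⧸ I` does not lie in the left ideal `I`. -/
theorem notMem_of_linearEquiv_quotient {A U : Type*} [Ring A] [AddCommGroup U] [Module A U]
    {e : A} (hc : ∀ x, e * x = x * e) {I : Ideal A} (f : U ≃ₗ[A] A ⧸ I)
    (hU : ∃ u : U, e • u ≠ 0) : e ∉ I := by
  rintro heI
  obtain ⟨u, hu⟩ := hU
  refine hu (f.injective ?_)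
  obtain ⟨a, ha⟩ := Submodule.Quotient.mk_surjective I (f u)
  rw [map_smul, map_zero, ← ha, ← Submodule.Quotient.mk_smul, Submodule.Quotient.mk_eq_zero,
    smul_eq_mul, hc]
  exact I.mul_mem_left _ heI

/-- Two simple modules on which `e` does not vanish are isomorphic, if `e` is central and
the quotient by the annihilator of `e` is local. -/
theorem IsSimpleModule.nonempty_linearEquiv_of_isLocalRing {A F S T : Type*} [Ring A] [Ring F]
    [IsLocalRing F] (p : A →+* F) (hp : Function.Surjective p) {e : A}
    (he : ∀ x, p x = 0 → e * x = 0) (hc : ∀ x, e * x = x * e)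
    [AddCommGroup S] [Module A S] [AddCommGroup T] [Module A T]
    [IsSimpleModule A S] [IsSimpleModule A T] (hS : ∃ s : S, e • s ≠ 0) (hT : ∃ t : T, e • t ≠ 0) :
    Nonempty (S ≃ₗ[A] T) := by
  obtain ⟨m, hm, ⟨f⟩⟩ := isSimpleModule_iff_quot_maximal.mp ‹IsSimpleModule A S›
  obtain ⟨n, hn, ⟨g⟩⟩ := isSimpleModule_iff_quot_maximal.mp ‹IsSimpleModule A T›
  obtain rfl := hm.eq_of_notMem_of_isLocalRing p hp he hn 
    (notMem_of_linearEquiv_quotient hc f hS) (notMem_of_linearEquiv_quotient hc g hT)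
  exact ⟨f.trans g.symm⟩

/-- Extensions of `M` by `N` split if a central element acts as zero on `M` and as the identity
on `N`. -/
theorem extOneVanishes_of_central {A : Type} [Ring A] {e : A} (hc : ∀ x, e * x = x * e)
    {M N : Type} [AddCommGroup M] [Module A M] [AddCommGroup N] [Module A N]
    (hM : ∀ m : M, e • m = 0) (hN : ∀ n : N, e • n = n) : ExtOneVanishes A M N := by
  intro E _ _ ι ρ _ hρ hex
  let f : E →ₗ[A] E :=
    { toFun := fun x => x - e • x
      map_add' := fun x y => by rw [smul_add]; abel
      map_smul' := fun a x => by
        rw [RingHom.id_apply, smul_sub, ← mul_smul, ← mul_smul, hc] }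
  have hf : LinearMap.ker ρ ≤ LinearMap.ker f := by
    rw [← hex]
    rintro _ ⟨n, rfl⟩
    change ι n - e • ι n = 0
    rw [← map_smul, hN, sub_self]
  refine ⟨(LinearMap.ker ρ).liftQ f hf ∘ₗ (ρ.quotKerEquivOfSurjective hρ).symm.toLinearMap, ?_⟩
  ext m
  obtain ⟨x, rfl⟩ := hρ m
  have : (ρ.quotKerEquivOfSurjective hρ).symm (ρ x) = Submodule.Quotient.mk x := by
    rw [LinearEquiv.symm_apply_eq]
    rfl
  change ρ ((LinearMap.ker ρ).liftQ f hf ((ρ.quotKerEquivOfSurjective hρ).symm (ρ x))) = ρ x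
  rw [this, Submodule.liftQ_apply]
  change ρ (x - e • x) = ρ x
  rw [map_sub, map_smul, hM, sub_zero]

/-- A finitely generated τ-rigid module over a finite product of local rings has no nonsplit
extensions by simple modules. -/
theorem TauRigid.extOneVanishes_of_isSimpleModule {A : Type} [Ring A] {ι : Type*} [Fintype ι]
    {F : ι → Type*} [∀ i, Ring (F i)] [∀ i, IsLocalRing (F i)] (iso : A ≃+* ((i : ι) → F i))
    {M : Type} [AddCommGroup M] [Module A M] [Module.Finite A M] (hM : TauRigid A M)
    (S : Type) [AddCommGroup S] [Module A S] [IsSimpleModule A S] : ExtOneVanishes A M S := by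
  classical
  let e : ι → A := fun i => iso.symm (Pi.single i 1)
  have hmul (i : ι) (x : A) : iso (e i * x) = Pi.single i (iso x i) := by
    simp only [e, map_mul, RingEquiv.apply_symm_apply]
    rw [← Pi.single_mul_left, one_mul]
  have hmul' (i : ι) (x : A) : iso (x * e i) = Pi.single i (iso x i) := by
    simp only [e, map_mul, RingEquiv.apply_symm_apply]
    rw [← Pi.single_mul_right, mul_one]
  have hc (i : ι) (x : A) : e i * x = x * e i := iso.injective (by rw [hmul, hmul'])
  have hidem (i : ι) : e i * e i = e i := iso.injective (by rw [hmul]; simp [e])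
  have hsum : ∑ i, e i = 1 := iso.injective (by
    simp only [e, map_sum, RingEquiv.apply_symm_apply, map_one]
    exact Finset.univ_sum_single (1 : (i : ι) → F i))
  have hlin (U : Type) [AddCommGroup U] [Module A U] (i : ι) :
      ∃ f : U →ₗ[A] U, ∀ u, f u = e i • u :=
    ⟨{ toFun := fun u => e i • u
       map_add' := smul_add _
       map_smul' := fun a u => by rw [RingHom.id_apply, ← mul_smul, ← mul_smul, hc] },
      fun _ => rfl⟩
  obtain ⟨s, hs⟩ := @exists_ne S (IsSimpleModule.nontrivial A S) 0
  obtain ⟨i, hi⟩ : ∃ i, e i • s ≠ 0 := by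
    by_contra! h
    refine hs ?_
    rw [← one_smul A s, ← hsum, Finset.sum_smul]
    exact Finset.sum_eq_zero fun i _ => h i
  have hid (u : S) : e i • u = u := by
    obtain ⟨f, hf⟩ := hlin S i
    have hker : LinearMap.ker f = ⊥ := (eq_bot_or_eq_top _).resolve_right fun h =>
      hi (by rw [← hf]; exact LinearMap.mem_ker.mp (h ▸ Submodule.mem_top))
    apply LinearMap.ker_eq_bot.mp hker
    rw [hf, hf, ← mul_smul, hidem]
  by_cases hz : ∀ m : M, e i • m = 0
  · exact extOneVanishes_of_central (hc i) hz hid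
  push Not at hz
  obtain ⟨m, hm⟩ := hz
  obtain ⟨f, hf⟩ := hlin M i
  have hne : LinearMap.ker f ≠ ⊤ := fun h =>
    hm (by rw [← hf]; exact LinearMap.mem_ker.mp (h ▸ Submodule.mem_top))
  obtain ⟨X, hX, hle⟩ := (eq_top_or_exists_le_coatom (LinearMap.ker f)).resolve_left hne
  have hT : IsSimpleModule A (M ⧸ X) := isSimpleModule_iff_isCoatom.mpr hX
  obtain ⟨x, hx⟩ : ∃ x, x ∉ X := by
    by_contra! h
    exact hX.1 (eq_top_iff.mpr fun x _ => h x)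
  have hTe : ∃ t : M ⧸ X, e i • t ≠ 0 := by
    refine ⟨Submodule.Quotient.mk x, fun h => hx ?_⟩
    rw [← Submodule.Quotient.mk_smul, Submodule.Quotient.mk_eq_zero] at h
    have hsub : x - e i • x ∈ X := hle (by
      rw [LinearMap.mem_ker, map_sub, hf, hf, ← mul_smul, hidem, sub_self])
    simpa using X.add_mem hsub h
  obtain ⟨g⟩ := IsSimpleModule.nonempty_linearEquiv_of_isLocalRing
    ((Pi.evalRingHom F i).comp (iso : A →+* ((i : ι) → F i)))
    ((Function.surjective_eval i).comp iso.surjective)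
    (fun x hx => iso.injective (by
      rw [hmul, map_zero, show iso x i = 0 from hx, Pi.single_zero])) (hc i)
    hTe ⟨s, hi⟩
  refine hM S ⟨1, g.toLinearMap ∘ₗ X.mkQ ∘ₗ LinearMap.proj 0, ?_⟩
  exact g.surjective.comp (X.mkQ_surjective.comp (Function.surjective_eval (0 : Fin 1)))

/-- The left ideal `A * f * A`. -/
def traceIdeal {A : Type*} [Ring A] (f : A) : Ideal A :=
  Ideal.span (Set.range fun b => f * b)

theorem mul_eq_zero_of_mem_traceIdeal {A M : Type*} [Ring A] [AddCommGroup M] [Module A M]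
    {f : A} {y : M} (h : ∀ b, (f * b) • y = 0) {x : A} (hx : x ∈ traceIdeal f) : x • y = 0 := by
  have : traceIdeal f ≤ LinearMap.ker (LinearMap.toSpanSingleton A M y) := by
    rw [traceIdeal, Ideal.span_le]
    rintro _ ⟨b, rfl⟩
    exact h b
  exact this hx

/-- For an idempotent `e`, the module `A ⧸ A(1 - e)A` is τ-rigid. -/
theorem tauRigid_quotient_traceIdeal {A : Type} [Ring A] {e : A} (he : IsIdempotentElem e) :
    TauRigid A (A ⧸ traceIdeal (1 - e)) := by
  rintro N _ _ ⟨k, φ, hφ⟩ E _ _ ι ρ - hρ hex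
  have hM (m : A ⧸ traceIdeal (1 - e)) : (1 - e) • m = 0 := by
    obtain ⟨a, rfl⟩ := Submodule.Quotient.mk_surjective _ m
    rw [← Submodule.Quotient.mk_smul, Submodule.Quotient.mk_eq_zero]
    exact Ideal.subset_span ⟨a, rfl⟩
  have hN (n : N) : (1 - e) • n = 0 := by
    obtain ⟨v, rfl⟩ := hφ n
    rw [← map_smul, show (1 - e) • v = 0 from funext fun i => hM _, map_zero]
  obtain ⟨x, hx⟩ := hρ (Submodule.Quotient.mk 1)
  have hy (b : A) : ((1 - e) * b) • e • x = 0 := by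
    have hmem : ((1 - e) * b) • e • x ∈ LinearMap.ker ρ := by
      rw [LinearMap.mem_ker, map_smul, mul_smul, hM]
    rw [← hex] at hmem
    obtain ⟨n, hn⟩ := hmem
    have h1 : (1 - e) • ((1 - e) * b) • e • x = 0 := by rw [← hn, ← map_smul, hN, map_zero]
    rwa [← mul_smul, ← mul_assoc, he.one_sub.eq] at h1
  refine ⟨(traceIdeal (1 - e)).liftQ (LinearMap.toSpanSingleton A E (e • x))
    fun a ha => mul_eq_zero_of_mem_traceIdeal hy ha, ?_⟩
  ext
  have h1 := hM (Submodule.Quotient.mk 1)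
  rw [sub_smul, one_smul, sub_eq_zero] at h1
  change ρ ((1 : A) • e • x) = Submodule.Quotient.mk 1
  rw [one_smul, map_smul, hx, ← h1]

/-- If `A ⧸ A(1 - e)A` is projective and `A(1 - e)Ae` is contained in the Jacobson radical, then
`(1 - e)Ae = 0`. -/
theorem one_sub_mul_mul_eq_zero_of_projective {A : Type*} [Ring A] {e : A}
    (he : IsIdempotentElem e)
    (hP : Module.Projective A (A ⧸ traceIdeal (1 - e)))
    (hrad : ∀ x ∈ traceIdeal (1 - e), IsUnit (1 - x * e)) (b : A) :
    (1 - e) * b * e = 0 := by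
  obtain ⟨σ, hσ⟩ := Module.projective_lifting_property (traceIdeal (1 - e)).mkQ LinearMap.id
    (Submodule.mkQ_surjective _)
  set u := σ (Submodule.Quotient.mk 1) with hu
  have hw : 1 - u ∈ traceIdeal (1 - e) := by
    rw [← Submodule.Quotient.mk_eq_zero, Submodule.Quotient.mk_sub, sub_eq_zero]
    exact (LinearMap.congr_fun hσ (Submodule.Quotient.mk 1)).symm
  have hz (c : A) : (1 - e) * c * u = 0 := by
    rw [hu, ← smul_eq_mul, ← map_smul, ← Submodule.Quotient.mk_smul, smul_eq_mul, mul_one,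
      (Submodule.Quotient.mk_eq_zero (traceIdeal (1 - e))).mpr (Ideal.subset_span ⟨c, rfl⟩),
      map_zero]
  have h0 : (1 - e) * b * e * (1 - (1 - u) * e) = 0 := by
    have h1 := hz (b * e)
    calc (1 - e) * b * e * (1 - (1 - u) * e)
        = (1 - e) * b * e - (1 - e) * b * (e * e) + (1 - e) * (b * e) * u * e := by noncomm_ring
      _ = 0 := by rw [h1, he.eq, sub_self, zero_mul, add_zero]
  exact (hrad _ hw).mul_left_eq_zero.mp h0

/-- An algebra `A` with a surjection onto `Kᵗ` whose kernel is nil is a finite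
product of local algebras if all its idempotents are central. -/
theorem nonempty_localDecomp_of_central {K A : Type} [Field K] [Ring A] [Algebra K A] {t : ℕ}
    (φ : A →ₐ[K] (Fin t → K)) (hφ : Function.Surjective φ)
    (hnil : ∀ x, φ x = 0 → IsNilpotent x)
    (hcent : ∀ e : A, IsIdempotentElem e → ∀ x, e * x = x * e) :
    Nonempty (LocalDecomp K A) := by
  obtain ⟨e, he, hφe⟩ := CompleteOrthogonalIdempotents.lift_of_isNilpotent_ker
    (φ : A →+* (Fin t → K)) hnil (CompleteOrthogonalIdempotents.single (fun _ : Fin t => K))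
    (fun i => hφ _)
  have hφe (i : Fin t) : φ (e i) = Pi.single i 1 := congrFun hφe i
  have hc (i : Fin t) (x : A) : e i * x = x * e i := hcent _ (he.idem i) x
  have hunit (a : A) (ha : IsUnit (φ a)) : IsUnit a := by
    obtain ⟨v, hv⟩ := ha
    obtain ⟨b, hb⟩ := hφ ((v⁻¹ : (Fin t → K)ˣ) : Fin t → K)
    have h1 : IsUnit (b * a) := by
      simpa using (hnil (1 - b * a) (by simp [hb, ← hv])).isUnit_one_sub
    have h2 : IsUnit (a * b) := by
      simpa using (hnil (1 - a * b) (by simp [hb, ← hv])).isUnit_one_sub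
    obtain ⟨c, hc⟩ := h1.exists_left_inv
    obtain ⟨d, hd⟩ := h2.exists_right_inv
    exact isUnit_iff_exists_and_exists.mpr
      ⟨⟨b * d, by rw [← mul_assoc, hd]⟩, ⟨c * b, by rw [mul_assoc, hc]⟩⟩
  let I : Fin t → Ideal A := fun i => LinearMap.ker (LinearMap.toSpanSingleton A A (e i))
  have hI (i : Fin t) (x : A) : x ∈ I i ↔ x * e i = 0 := Iff.rfl
  have htwo (i : Fin t) : (I i).IsTwoSided := ⟨fun {a} b ha => by
    rw [hI] at ha ⊢
    rw [mul_assoc, ← hc, ← mul_assoc, ha, zero_mul]⟩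
  have hmk (i : Fin t) (x y : A) : Ideal.Quotient.mk (I i) x = Ideal.Quotient.mk (I i) y ↔
      x * e i = y * e i := by
    rw [Ideal.Quotient.mk_eq_mk_iff_sub_mem, hI, sub_mul, sub_eq_zero]
  have hloc (i : Fin t) (x : A) (hx : φ x i ≠ 0) : IsUnit (Ideal.Quotient.mk (I i) x) := by
    have h1 : IsUnit (x * e i + (1 - e i)) := by
      refine hunit _ (Pi.isUnit_iff.mpr fun j => ?_)
      rw [map_add, map_mul, map_sub, map_one, hφe]
      by_cases hj : j = i
      · subst hj
        simpa using hx
      · simp [hj]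
    convert h1.map (Ideal.Quotient.mk (I i)) using 1
    rw [hmk, add_mul, sub_mul, mul_assoc, (he.idem i).eq, one_mul, sub_self, add_zero]
  refine ⟨{ t := t, F := fun i => A ⧸ I i, localF := fun i => ?_, iso :=
    AlgEquiv.ofBijective (AlgHom.pi fun i => Ideal.Quotient.mkₐ K (I i)) ⟨?_, ?_⟩ }⟩
  · have : Nontrivial (A ⧸ I i) := by
      refine ⟨Ideal.Quotient.mk (I i) 1, Ideal.Quotient.mk (I i) 0, fun h => ?_⟩
      rw [hmk, one_mul, zero_mul] at h
      have := congrFun (hφe i) i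
      simp [h] at this
    refine ⟨fun {a b} hab => ?_⟩
    obtain ⟨x, rfl⟩ := Ideal.Quotient.mk_surjective a
    obtain ⟨y, rfl⟩ := Ideal.Quotient.mk_surjective b
    rw [← map_add, ← map_one (Ideal.Quotient.mk (I i)), hmk] at hab
    have h1 : φ x i + φ y i = 1 := by
      simpa [hφe] using congrFun (congrArg φ hab) i
    by_cases hx : φ x i = 0
    · exact Or.inr (hloc i y fun hy => by simp [hx, hy] at h1)
    · exact Or.inl (hloc i x hx)
  · intro x y hxy
    rw [← mul_one x, ← mul_one y, ← he.complete, Finset.mul_sum, Finset.mul_sum]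
    exact Finset.sum_congr rfl fun i _ => (hmk i x y).mp (congrFun hxy i)
  · intro z
    choose x hx using fun i => Ideal.Quotient.mk_surjective (z i)
    refine ⟨∑ j, x j * e j, funext fun i => ?_⟩
    rw [← hx i]
    refine (hmk i _ _).mpr ?_
    rw [Finset.sum_mul, Finset.sum_eq_single i]
    · rw [mul_assoc, (he.idem i).eq]
    · intro j _ hj
      rw [mul_assoc, he.ortho hj, mul_zero]
    · simp

theorem stmt10 (K A : Type) [Field K] [IsAlgClosed K] [Ring A] [Algebra K A]
    [FiniteDimensional K A]
    -- `A` is basic: `A / rad(A)` is isomorphic to a finite product of copies of `K`.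
    (hbasic : ∃ (t : ℕ) (φ : A →ₐ[K] (Fin t → K)),
      Function.Surjective φ ∧
        RingHom.ker (φ : A →+* (Fin t → K)) = Ideal.jacobson (⊥ : Ideal A)) :
    Nonempty (LocalDecomp K A) ↔
      ∀ (M : Type) [AddCommGroup M] [Module A M] [Module K M] [IsScalarTower K A M]
        [FiniteDimensional K M], TauRigid A M → Module.Projective A M := by
  constructor
  · rintro ⟨D⟩ M _ _ _ _ _ hM
    let := D.ringF
    let := D.algF
    have := D.localF
    have : IsArtinianRing A := .of_finite K A
    have : Module.Finite A M := .of_restrictScalars_finite K A M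
    exact projective_of_extOneVanishes_of_isSimpleModule A M fun S _ _ _ =>
      hM.extOneVanishes_of_isSimpleModule D.iso.toRingEquiv S
  · intro h
    obtain ⟨t, φ, hφ, hker⟩ := hbasic
    have : IsArtinianRing A := .of_finite K A
    have hnil (x : A) (hx : φ x = 0) : IsNilpotent x := by
      obtain ⟨n, hn⟩ := IsArtinianRing.isNilpotent_jacobson_bot (R := A)
      refine ⟨n, ?_⟩
      have hmem : x ∈ Ideal.jacobson (⊥ : Ideal A) := hker ▸ hx
      have := Ideal.pow_mem_pow hmem n
      rwa [hn] at this
    have hzero (e : A) (he : IsIdempotentElem e) (b : A) : (1 - e) * b * e = 0 := by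
      refine one_sub_mul_mul_eq_zero_of_projective he
        (h _ (tauRigid_quotient_traceIdeal he)) (fun x hx => (hnil _ ?_).isUnit_one_sub) b
      have hle : traceIdeal (1 - e) ≤ (Ideal.span {φ (1 - e)}).comap φ := by
        rw [traceIdeal, Ideal.span_le]
        rintro _ ⟨b, rfl⟩
        exact Ideal.mem_span_singleton.mpr ⟨φ b, map_mul φ _ _⟩
      obtain ⟨c, hc⟩ := Ideal.mem_span_singleton.mp (hle hx)
      rw [map_mul, hc, mul_right_comm, ← map_mul, sub_mul, one_mul, he.eq, sub_self, map_zero,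
        zero_mul]
    refine nonempty_localDecomp_of_central φ hφ hnil fun e he x => ?_
    have h1 := hzero e he x
    have h2 := hzero (1 - e) he.one_sub x
    rw [sub_sub_cancel, mul_sub, mul_one, sub_eq_zero] at h2
    rw [sub_mul, one_mul, sub_mul, sub_eq_zero] at h1
    rw [h2, h1]
end

section
/- Let A be a basic, connected finite-dimensional algebra over an algebraically closed field K which is not local. Then there exists a non-projective finite-dimensional A-module E such that Ext^1_A(E, N) = 0 for every A-module N that is a quotient of a finite direct sum of copies of E (i.e., E is a non-projective τ-rigid module). -/
/-- The data of a non-projective τ-rigid finite-dimensional `A`-module. -/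
structure NonProjTauRigid (K : Type) [Field K] (A : Type) [Ring A] [Algebra K A] :
    Type 1 where
  E : Type
  [acg : AddCommGroup E]
  [mod : Module A E]
  [modK : Module K E]
  [tow : IsScalarTower K A E]
  findim : FiniteDimensional K E
  nonproj : ¬ Module.Projective A E
  rigid : TauRigid A E

/-- An element whose image is a unit is a unit, for a surjection with nil kernel. -/
theorem isUnit_of_map_of_ker_isNilpotent {R S : Type*} [Ring R] [Ring S] (f : R →+* S)
    (hf : Function.Surjective f) (hnil : ∀ x ∈ RingHom.ker f, IsNilpotent x) {a : R}
    (ha : IsUnit (f a)) : IsUnit a := by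
  obtain ⟨u, hu⟩ := ha
  obtain ⟨c, hc⟩ := hf (↑u⁻¹ : S)
  have unit_of {x : R} (hx : f x = 1) : IsUnit x := by
    simpa using (hnil (1 - x) (by simp [RingHom.mem_ker, hx])).isUnit_one_sub
  have hac : IsUnit (a * c) := unit_of (by rw [map_mul, ← hu, hc, Units.mul_inv])
  have hca : IsUnit (c * a) := unit_of (by rw [map_mul, ← hu, hc, Units.inv_mul])
  obtain ⟨r, hr⟩ := hac.exists_right_inv
  obtain ⟨l, hl⟩ := hca.exists_left_inv
  exact isUnit_iff_exists_and_exists.2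
    ⟨⟨c * r, by rw [← mul_assoc, hr]⟩, ⟨l * c, by rw [mul_assoc, hl]⟩⟩

/-- A ring with a nil-kernel surjection onto a finite power of a field has a nontrivial
idempotent unless it is local. -/
theorem exists_nontrivial_isIdempotentElem {R K : Type*} [Ring R] [Nontrivial R] [Field K] {t : ℕ}
    (f : R →+* (Fin t → K)) (hf : Function.Surjective f)
    (hnil : ∀ x ∈ RingHom.ker f, IsNilpotent x) (hloc : ¬ IsLocalRing R) :
    ∃ e : R, IsIdempotentElem e ∧ e ≠ 0 ∧ e ≠ 1 := by
  obtain ⟨a, b, hab, ha, hb⟩ : ∃ a b : R, a + b = 1 ∧ ¬ IsUnit a ∧ ¬ IsUnit b := by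
    by_contra! h
    exact hloc ⟨fun {a b} hab => or_iff_not_imp_left.2 (h a b hab)⟩
  have vanish {x : R} (hx : ¬ IsUnit x) : ∃ i, f x i = 0 := by
    by_contra! h
    exact hx (isUnit_of_map_of_ker_isNilpotent f hf hnil (Pi.isUnit_iff.2 fun i => (h i).isUnit))
  obtain ⟨i, hi⟩ := vanish ha
  obtain ⟨j, hj⟩ := vanish hb
  have hij : j ≠ i := by
    rintro rfl
    have h := congrFun (congrArg f hab) j
    simp [hi, hj] at h
  obtain ⟨e, he, hfe⟩ := exists_isIdempotentElem_eq_of_ker_isNilpotent f hnil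
    (Pi.single i 1) (hf _) (by simp [IsIdempotentElem, ← Pi.single_mul])
  refine ⟨e, he, ?_, ?_⟩
  · rintro rfl
    simpa using congrFun hfe i
  · rintro rfl
    simpa [hij] using congrFun hfe j

/-- The left annihilator of an idempotent is a projective left ideal. -/
theorem projective_ker_toSpanSingleton {A : Type*} [Ring A] {e : A} (he : IsIdempotentElem e) :
    Module.Projective A (LinearMap.ker (LinearMap.toSpanSingleton A A e)) := by
  refine Module.Projective.of_split (Submodule.subtype _)
    ((LinearMap.toSpanSingleton A A (1 - e)).codRestrict _ fun c => ?_) ?_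
  · simp [mul_assoc, sub_mul, he.eq]
  · ext x
    have hx : (x : A) * e = 0 := x.2
    simp [mul_sub, hx]

theorem projective_fin_fun (A M : Type*) [Ring A] [AddCommGroup M] [Module A M]
    [Module.Projective A M] (n : ℕ) : Module.Projective A (Fin n → M) :=
  Module.Projective.of_equiv (DFinsupp.linearEquivFunOnFintype (R := A) (M := fun _ : Fin n => M))

/-- The quotient of a projective module by a cyclic submodule `A b` with `e b = b` is τ-rigid as
soon as every element of the form `e x` is the image of `b` under an endomorphism. -/
theorem tauRigid_quotient_span_singleton {A Q : Type} [Ring A] [AddCommGroup Q] [Module A Q]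
    [Module.Projective A Q] (e : A) (b : Q) (hb : e • b = b)
    (happrox : ∀ x : Q, ∃ h : Q →ₗ[A] Q, h b = e • x) :
    TauRigid A (Q ⧸ Submodule.span A {b}) := by
  intro N _ _ ⟨k, φ, hφ⟩ X _ _ ι ρ hι hρ hex
  obtain ⟨q, hq⟩ := Module.projective_lifting_property ρ (Submodule.span A {b}).mkQ hρ
  have hqb : q b ∈ LinearMap.range ι := by
    rw [hex, LinearMap.mem_ker, ← LinearMap.comp_apply, hq]
    simp
  obtain ⟨m, hm⟩ := hqb
  have hem : e • m = m := hι (by rw [map_smul, hm, ← map_smul, hb])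
  obtain ⟨y, hy⟩ := hφ m
  choose x hx using fun j => (Submodule.span A {b}).mkQ_surjective (y j)
  choose h hh using fun j => happrox (x j)
  let H : Q →ₗ[A] N := φ ∘ₗ LinearMap.pi fun j => (Submodule.span A {b}).mkQ ∘ₗ h j
  have hH : H b = m := by
    have : (fun j => (Submodule.span A {b}).mkQ (h j b)) = e • y := by
      funext j
      rw [hh, map_smul, hx, Pi.smul_apply]
    calc H b = φ (fun j => (Submodule.span A {b}).mkQ (h j b)) := rfl
      _ = m := by rw [this, map_smul, hy, hem]
  have hker : Submodule.span A {b} ≤ LinearMap.ker (q - ι ∘ₗ H) := by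
    rw [Submodule.span_singleton_le_iff_mem, LinearMap.mem_ker]
    simp [hH, hm]
  refine ⟨(Submodule.span A {b}).liftQ _ hker, Submodule.linearMap_qext _ ?_⟩
  ext z
  have h1 : ρ (q z) = (Submodule.span A {b}).mkQ z := LinearMap.congr_fun hq z
  have h2 : ρ (ι (H z)) = 0 := by
    rw [← LinearMap.mem_ker, ← hex]
    exact ⟨_, rfl⟩
  simpa [h2] using h1

/-- If the coordinates of `b ∈ Qⁿ` with respect to generators `g` act through radical elements,
and `b ≠ 0`, then the quotient by the cyclic submodule `A b` is not projective. -/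
theorem not_projective_quotient_span_singleton {A Q ι : Type*} [Ring A] [AddCommGroup Q]
    [Module A Q] [Fintype ι] (c : ι → A) (g : ι → Q) (b : Q) (hb : b = ∑ i, c i • g i)
    (hb0 : b ≠ 0) (hc : ∀ d : ι → A, IsUnit (1 - ∑ i, c i * d i)) :
    ¬ Module.Projective A (Q ⧸ Submodule.span A {b}) := by
  intro hproj
  obtain ⟨s, hs⟩ := Module.projective_lifting_property (Submodule.span A {b}).mkQ LinearMap.id
    (Submodule.mkQ_surjective _)
  have hmem (x : Q) : ∃ d : A, d • b = x - s ((Submodule.span A {b}).mkQ x) := by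
    rw [← Submodule.mem_span_singleton, ← Submodule.Quotient.mk_eq_zero, ← Submodule.mkQ_apply,
      map_sub]
    have := LinearMap.congr_fun hs ((Submodule.span A {b}).mkQ x)
    rw [LinearMap.comp_apply, LinearMap.id_apply] at this
    rw [this, sub_self]
  choose d hd using fun i => hmem (g i)
  have key : (1 - ∑ i, c i * d i) • b = 0 := by
    have h0 : (Submodule.span A {b}).mkQ b = 0 := by simp
    have h1 : ∑ i, c i • s ((Submodule.span A {b}).mkQ (g i)) = 0 := by
      simp only [← map_smul, ← map_sum]
      rw [← hb, h0, map_zero]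
    simp only [sub_smul, one_smul, Finset.sum_smul, mul_smul, hd, smul_sub,
      Finset.sum_sub_distrib, h1, ← hb]
    simp
  exact hb0 ((hc d).smul_eq_zero.1 key)

/-- For an idempotent `e` with `e A (1 - e)` nonzero, the cokernel of the left
`add (A (1 - e))`-approximation of `A e` is a non-projective τ-rigid module. -/
theorem nonempty_nonProjTauRigid_of_idempotent {K A : Type} [Field K] [Ring A] [Algebra K A]
    [FiniteDimensional K A] {e : A} (he : IsIdempotentElem e) {a : A} (ha : e * a * (1 - e) ≠ 0)
    (hrad : ∀ (n : ℕ) (x d : Fin n → A), IsUnit (1 - ∑ i, e * x i * (1 - e) * d i)) :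
    Nonempty (NonProjTauRigid K A) := by
  let Q := LinearMap.ker (LinearMap.toSpanSingleton A A e)
  let n := Module.finrank K A
  let B : Module.Basis (Fin n) K A := Module.finBasis K A
  have h1e : (1 - e) * e = 0 := by rw [sub_mul, one_mul, he.eq, sub_self]
  have hQ (x : Q) : (x : A) * (1 - e) = x := by
    have hx : (x : A) * e = 0 := x.2
    rw [mul_sub, mul_one, hx, sub_zero]
  let f : Q := ⟨1 - e, by simp [Q, h1e]⟩
  let c (i : Fin n) : A := e * B i * (1 - e)
  let b : Fin n → Q := fun i => c i • f
  have hbi (i : Fin n) : (b i : A) = c i := by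
    change e * B i * (1 - e) * (1 - e) = _
    rw [mul_assoc, he.one_sub.eq]
  have hspan (x : A) : e * x * (1 - e) = ∑ i, B.repr x i • c i := by
    conv_lhs => rw [← B.sum_repr x, Finset.mul_sum, Finset.sum_mul]
    simp only [c, mul_smul_comm, smul_mul_assoc]
  have hb0 : b ≠ 0 := by
    intro hb
    refine ha ?_
    rw [hspan]
    refine Finset.sum_eq_zero fun i _ => ?_
    rw [← hbi, hb]
    simp
  have := projective_ker_toSpanSingleton he
  have := projective_fin_fun A Q n
  refine ⟨{ E := (Fin n → Q) ⧸ Submodule.span A {b}, findim := ?_, nonproj := ?_, rigid := ?_ }⟩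
  · have : FiniteDimensional K Q :=
      inferInstanceAs (FiniteDimensional K (Q.restrictScalars K))
    exact Module.Finite.quotient K (Submodule.span A {b})
  · refine not_projective_quotient_span_singleton c (fun i => Pi.single i f) b ?_ hb0
      fun d => hrad n _ d
    funext j
    simp [b, Finset.sum_apply, Pi.single_apply]
  · refine tauRigid_quotient_span_singleton e b ?_ fun x => ?_
    · funext i
      ext
      simp [hbi, c, ← mul_assoc, he.eq]
    · refine ⟨LinearMap.pi fun j => ∑ i, B.repr (x j : A) i • LinearMap.proj i, ?_⟩
      funext j
      ext
      have h := hspan (x j : A)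
      rw [mul_assoc, hQ] at h
      simp [h, hbi]

theorem stmt11 (K A : Type) [Field K] [IsAlgClosed K] [Ring A] [Algebra K A]
    [FiniteDimensional K A] [Nontrivial A]
    -- `A` is basic: `A / rad(A)` is isomorphic to a finite product of copies of `K`.
    (hbasic : ∃ (t : ℕ) (φ : A →ₐ[K] (Fin t → K)),
      Function.Surjective φ ∧
        RingHom.ker (φ : A →+* (Fin t → K)) = Ideal.jacobson (⊥ : Ideal A))
    -- `A` is connected: the only central idempotents are `0` and `1`.
    (hconn : ∀ a : A, IsIdempotentElem a → a ∈ Set.center A → a = 0 ∨ a = 1)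
    -- `A` is not local.
    (hnotlocal : ¬ IsLocalRing A) :
    Nonempty (NonProjTauRigid K A) := by
  obtain ⟨t, φ, hφ, hker⟩ := hbasic
  have : IsArtinianRing A := IsArtinianRing.of_finite K A
  have hnil : ∀ x ∈ RingHom.ker (φ : A →+* (Fin t → K)), IsNilpotent x := by
    intro x hx
    rw [hker] at hx
    obtain ⟨n, hn⟩ := IsArtinianRing.isNilpotent_jacobson_bot (R := A)
    have hxn := Ideal.pow_mem_pow hx n
    rw [hn] at hxn
    exact ⟨n, hxn⟩
  obtain ⟨e, he, he0, he1⟩ :=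
    exists_nontrivial_isIdempotentElem (φ : A →+* (Fin t → K)) hφ hnil hnotlocal
  have hrad {e : A} (he : IsIdempotentElem e) (n : ℕ) (x d : Fin n → A) :
      IsUnit (1 - ∑ i, e * x i * (1 - e) * d i) := by
    refine (hnil _ ?_).isUnit_one_sub
    rw [RingHom.mem_ker]
    simp only [map_sum]
    refine Finset.sum_eq_zero fun i _ => ?_
    have h : φ e * (1 - φ e) = 0 := by
      rw [← map_one φ, ← map_sub, ← map_mul, mul_sub, mul_one, he.eq, sub_self, map_zero]
    simp only [RingHom.coe_coe, map_mul, map_sub, map_one]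
    linear_combination (φ (x i) * φ (d i)) * h
  by_cases h : ∃ a, e * a * (1 - e) ≠ 0
  · obtain ⟨a, ha⟩ := h
    exact nonempty_nonProjTauRigid_of_idempotent he ha (hrad he)
  by_cases h' : ∃ a, (1 - e) * a * e ≠ 0
  · obtain ⟨a, ha⟩ := h'
    exact nonempty_nonProjTauRigid_of_idempotent he.one_sub (a := a) (by simpa using ha)
      (hrad he.one_sub)
  push Not at h h'
  refine ((hconn e he (Semigroup.mem_center_iff.2 fun a => ?_)).elim he0 he1).elim
  have h1 := h a
  have h2 := h' a
  rw [mul_sub, mul_one, sub_eq_zero] at h1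
  rw [sub_mul, sub_mul, one_mul, sub_eq_zero] at h2
  rw [h1, h2]
end

section
/- Let P_1 and P_0 be finite-dimensional projective A-modules and let f, f' : P_1 → P_0 be homomorphisms. Then Coker(f) ≅ Coker(f') as A-modules if and only if there exist A-module automorphisms g_1 of P_1 and g_0 of P_0 such that f' = g_0 ∘ f ∘ g_1^{-1}. -/
/-- Let `V` be semisimple. If an endomorphism `h` is surjective modulo `N`, it becomes surjective
after adding a suitable endomorphism with values in `N`. -/
theorem exists_range_le_surjective_add_of_isSemisimpleModule (K : Type*) {A V : Type*}
    [Field K] [Ring A] [Algebra K A] [AddCommGroup V] [Module A V] [Module K V]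
    [IsScalarTower K A V] [FiniteDimensional K V] [IsNoetherian A V] [IsSemisimpleModule A V]
    (N : Submodule A V) (h : V →ₗ[A] V) (hN : LinearMap.range h ⊔ N = ⊤) :
    ∃ d : V →ₗ[A] V, LinearMap.range d ≤ N ∧ Function.Surjective (h + d) := by
  induction hR : LinearMap.range h using WellFoundedGT.induction generalizing h with
  | ind R ih =>
  subst hR
  by_cases htop : LinearMap.range h = ⊤
  · exact ⟨0, by simp, by simpa using LinearMap.range_eq_top.1 htop⟩
  have hNR : ¬ N ≤ LinearMap.range h := fun hle => htop (by rwa [sup_eq_left.2 hle] at hN)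
  obtain ⟨S, hS, hSN, hSR⟩ : ∃ S : Submodule A V, IsSimpleModule A S ∧ S ≤ N ∧
      ¬ S ≤ LinearMap.range h := by
    by_contra! hcon
    apply hNR
    rw [← sSup_atoms_le_eq N]
    exact sSup_le fun S hS => hcon S (isSimpleModule_iff_isAtom.2 hS.1) hS.2
  have : FiniteDimensional K S :=
    Module.Finite.of_injective (S.subtype.restrictScalars K) S.subtype_injective
  have : FiniteDimensional K (S →ₗ[A] V) :=
    Module.Finite.of_injective (LinearMap.restrictScalarsₗ K A S V K)
      (LinearMap.restrictScalars_injective K)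
  let F : (S →ₗ[A] V) →ₗ[K] (S →ₗ[A] V) :=
    { toFun := fun u => h ∘ₗ u
      map_add' := fun u v => LinearMap.comp_add _ _ _
      map_smul' := fun c u => by
        ext x
        exact (h.restrictScalars K).map_smul c (u x) }
  have hF : ¬ Function.Injective F := fun hinj => by
    obtain ⟨u, hu⟩ := LinearMap.injective_iff_surjective.1 hinj S.subtype
    exact hSR fun x hx => ⟨u ⟨x, hx⟩, LinearMap.congr_fun hu ⟨x, hx⟩⟩
  obtain ⟨i, hi, hi0⟩ : ∃ i : S →ₗ[A] V, h ∘ₗ i = 0 ∧ i ≠ 0 := by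
    by_contra! hcon
    exact hF ((injective_iff_map_eq_zero F).2 hcon)
  obtain ⟨r, hr⟩ := IsSemisimpleModule.extension_property i
    (i.injective_of_ne_zero hi0) LinearMap.id
  have hri (s : S) : r (i s) = s := LinearMap.congr_fun hr s
  have hhi (s : S) : h (i s) = 0 := LinearMap.congr_fun hi s
  set e : V →ₗ[A] V := S.subtype ∘ₗ r with he
  have hSe : S ≤ LinearMap.range (h + e) := fun x hx => ⟨i ⟨x, hx⟩, by simp [he, hri, hhi]⟩
  have hRe : LinearMap.range h ≤ LinearMap.range (h + e) := by
    rintro _ ⟨v, rfl⟩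
    exact ⟨v - i (r v), by simp [he, hri, hhi]⟩
  obtain ⟨d, hd, hsurj⟩ := ih _ (lt_of_le_of_ne hRe fun heq => hSR (heq ▸ hSe)) (h + e)
    (top_le_iff.1 (hN.ge.trans (sup_le_sup_right hRe N))) rfl
  refine ⟨e + d, ?_, by rwa [← add_assoc]⟩
  rintro _ ⟨v, rfl⟩
  exact N.add_mem (hSN (r v).2) (hd ⟨v, rfl⟩)

/-- Two surjections from a finite-dimensional projective module onto the same module differ by an
automorphism of the source. -/
theorem Module.Projective.exists_linearEquiv_comp_eq (K : Type*) {A P M : Type*} [Field K] [Ring A]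
    [Algebra K A] [AddCommGroup P] [Module A P] [Module K P] [IsScalarTower K A P]
    [FiniteDimensional K P] [Module.Projective A P] [AddCommGroup M] [Module A M]
    (p q : P →ₗ[A] M) (hp : Function.Surjective p) (hq : Function.Surjective q) :
    ∃ g : P ≃ₗ[A] P, q ∘ₗ (g : P →ₗ[A] P) = p := by
  have : IsNoetherian A P := isNoetherian_of_tower K inferInstance
  have : IsArtinian A P := isArtinian_of_tower K inferInstance
  obtain ⟨h, hh⟩ := Module.projective_lifting_property q p hq
  have hqh (x : P) : q (h x) = p x := LinearMap.congr_fun hh x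
  let J := Module.jacobson A P
  have : IsSemisimpleModule A (P ⧸ J) := by
    rw [IsArtinian.isSemisimpleModule_iff_jacobson]
    exact Module.jacobson_quotient_jacobson A P
  let N := LinearMap.ker q
  let hbar : (P ⧸ J) →ₗ[A] (P ⧸ J) := J.mapQ J h (Module.le_comap_jacobson h)
  have hN : LinearMap.range hbar ⊔ N.map J.mkQ = ⊤ := by
    rw [eq_top_iff]
    rintro x -
    obtain ⟨x, rfl⟩ := J.mkQ_surjective x
    obtain ⟨y, hy⟩ := hp (q x)
    refine Submodule.mem_sup.2 ⟨_, ⟨J.mkQ y, rfl⟩, _, ⟨x - h y, ?_, rfl⟩, ?_⟩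
    · simp [N, hqh, hy]
    · simp [hbar]
  obtain ⟨dbar, hd, hsurj⟩ :=
    exists_range_le_surjective_add_of_isSemisimpleModule K (N.map J.mkQ) hbar hN
  obtain ⟨d, hd'⟩ := Module.projective_lifting_property (J.mkQ.submoduleMap N)
    ((dbar.codRestrict _ fun x => hd ⟨x, rfl⟩) ∘ₗ J.mkQ) (J.mkQ.submoduleMap_surjective N)
  have hdq (x : P) : J.mkQ (d x) = dbar (J.mkQ x) :=
    congrArg Subtype.val (LinearMap.congr_fun hd' x)
  let g : P →ₗ[A] P := h + N.subtype ∘ₗ d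
  have hg : Function.Surjective g := by
    rw [← LinearMap.range_eq_top]
    by_contra hne
    obtain ⟨C, hC, hle⟩ := (eq_top_or_exists_le_coatom (LinearMap.range g)).resolve_left hne
    refine hC.1 (eq_top_iff.2 ?_)
    rintro x -
    obtain ⟨y, hy⟩ := hsurj (J.mkQ x)
    obtain ⟨y, rfl⟩ := J.mkQ_surjective y
    have hxy : J.mkQ (g y) = J.mkQ x := by
      rw [← hy]
      simp only [g, LinearMap.add_apply, map_add, LinearMap.comp_apply, Submodule.subtype_apply,
        hdq]
      rfl
    have hJ : g y - x ∈ J := (Submodule.Quotient.eq J).1 hxy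
    have hJC : J ≤ C := sInf_le hC
    simpa using C.sub_mem (hle ⟨y, rfl⟩) (hJC hJ)
  refine ⟨LinearEquiv.ofBijective g
    ⟨IsNoetherian.injective_of_surjective_endomorphism g hg, hg⟩, ?_⟩
  ext x
  have : q (d x : P) = 0 := (d x).2
  change q (h x + d x) = p x
  rw [map_add, hqh, this, add_zero]

theorem stmt12 {K A : Type*} [Field K] [IsAlgClosed K] [Ring A] [Algebra K A]
    [FiniteDimensional K A]
    {P₁ P₀ : Type*}
    [AddCommGroup P₁] [Module A P₁] [Module K P₁] [IsScalarTower K A P₁] [FiniteDimensional K P₁]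
    [AddCommGroup P₀] [Module A P₀] [Module K P₀] [IsScalarTower K A P₀] [FiniteDimensional K P₀]
    (hP₁proj : Module.Projective A P₁) (hP₀proj : Module.Projective A P₀)
    (f f' : P₁ →ₗ[A] P₀) :
    Nonempty ((P₀ ⧸ LinearMap.range f) ≃ₗ[A] (P₀ ⧸ LinearMap.range f')) ↔
      ∃ (g₁ : P₁ ≃ₗ[A] P₁) (g₀ : P₀ ≃ₗ[A] P₀),
        f' = (g₀ : P₀ →ₗ[A] P₀) ∘ₗ f ∘ₗ (g₁.symm : P₁ →ₗ[A] P₁) := by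
  constructor
  · rintro ⟨φ⟩
    obtain ⟨g₀, hg₀⟩ := Module.Projective.exists_linearEquiv_comp_eq K
      ((φ : _ →ₗ[A] _) ∘ₗ (LinearMap.range f).mkQ) (LinearMap.range f').mkQ
      (φ.surjective.comp (Submodule.mkQ_surjective _)) (Submodule.mkQ_surjective _)
    have hmem (x : P₀) : g₀ x ∈ LinearMap.range f' ↔ x ∈ LinearMap.range f := by
      have hx : (LinearMap.range f').mkQ (g₀ x) = φ ((LinearMap.range f).mkQ x) :=
        LinearMap.congr_fun hg₀ x
      rw [← Submodule.Quotient.mk_eq_zero, ← Submodule.mkQ_apply, hx, φ.map_eq_zero_iff,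
        Submodule.mkQ_apply, Submodule.Quotient.mk_eq_zero]
    obtain ⟨g₁, hg₁⟩ := Module.Projective.exists_linearEquiv_comp_eq K
      (((g₀ : P₀ →ₗ[A] P₀) ∘ₗ f).codRestrict (LinearMap.range f')
        fun x => (hmem (f x)).2 ⟨x, rfl⟩) f'.rangeRestrict
      (by
        rintro ⟨y, hy⟩
        obtain ⟨z, rfl⟩ := g₀.surjective y
        obtain ⟨x, rfl⟩ := (hmem z).1 hy
        exact ⟨x, rfl⟩)
      f'.surjective_rangeRestrict
    refine ⟨g₁, g₀, LinearMap.ext fun x => ?_⟩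
    have hx : f' (g₁ (g₁.symm x)) = g₀ (f (g₁.symm x)) :=
      congrArg Subtype.val (LinearMap.congr_fun hg₁ (g₁.symm x))
    simpa using hx
  · rintro ⟨g₁, g₀, rfl⟩
    refine ⟨Submodule.Quotient.equiv _ _ g₀ ?_⟩
    rw [LinearMap.range_comp, LinearMap.range_comp_of_range_eq_top _ g₁.symm.range]
end

section
/- Let P_1 and P_0 be finite-dimensional projective A-modules and let f : P_1 → P_0 be a homomorphism. Then there exist direct sum decompositions P_1 = Q_1 ⊕ R ⊕ Q and P_0 = Q_0 ⊕ R' such that: f(Q_1) ⊆ Q_0; f restricts to an isomorphism R → R'; f(Q) = 0; the restriction f' : Q_1 → Q_0 satisfies Im(f') ⊆ rad(Q_0) and Ker(f') ⊆ rad(Q_1). Moreover, in any such decomposition the modules Q_1, Q_0, R and Q are uniquely determined up to isomorphism by f. -/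
/-- The radical `rad(A)·N` of a submodule `N` (as a submodule of the ambient module),
where `rad(A)` is the Jacobson radical of `A`. -/
noncomputable def radOf {A P : Type*} [Ring A] [AddCommGroup P] [Module A P]
    (N : Submodule A P) : Submodule A P :=
  Submodule.span A {x : P | ∃ r ∈ Ideal.jacobson (⊥ : Ideal A), ∃ p ∈ N, r • p = x}

/-- The decomposition of a map `f : P₁ → P₀` between projectives as a direct sum of a
minimal projective presentation `Q₁ → Q₀`, an isomorphism `R ≅ R'`, and a map `Q → 0`:
`P₁ = Q₁ ⊕ R ⊕ Q` and `P₀ = Q₀ ⊕ R'` (internal direct sums) with `f(Q₁) ⊆ Q₀`,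
`f` restricting to an isomorphism `R → R'`, `f(Q) = 0`, and the restriction
`f' : Q₁ → Q₀` satisfying `Im(f') ⊆ rad(Q₀)` and `Ker(f') ⊆ rad(Q₁)`. -/
def IsCanonDecomp {A P₁ P₀ : Type*} [Ring A]
    [AddCommGroup P₁] [Module A P₁] [AddCommGroup P₀] [Module A P₀]
    (f : P₁ →ₗ[A] P₀)
    (Q₁ R Q : Submodule A P₁) (Q₀ R' : Submodule A P₀) : Prop :=
  -- `P₁ = Q₁ ⊕ R ⊕ Q` internally
  Q₁ ⊓ R = ⊥ ∧ (Q₁ ⊔ R) ⊓ Q = ⊥ ∧ Q₁ ⊔ R ⊔ Q = ⊤ ∧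
  -- `P₀ = Q₀ ⊕ R'` internally
  Q₀ ⊓ R' = ⊥ ∧ Q₀ ⊔ R' = ⊤ ∧
  -- `f(Q₁) ⊆ Q₀`
  Submodule.map f Q₁ ≤ Q₀ ∧
  -- `f` restricts to an isomorphism `R → R'`
  Submodule.map f R = R' ∧ (∀ x ∈ R, f x = 0 → x = 0) ∧
  -- `f(Q) = 0`
  Q ≤ LinearMap.ker f ∧
  -- the restriction `f' : Q₁ → Q₀` satisfies `Im(f') ⊆ rad(Q₀)` and `Ker(f') ⊆ rad(Q₁)`
  Submodule.map f Q₁ ≤ radOf Q₀ ∧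
  LinearMap.ker f ⊓ Q₁ ≤ radOf Q₁

section Radical

open Submodule

variable {A P P' : Type*} [Ring A] [AddCommGroup P] [Module A P] [AddCommGroup P'] [Module A P']

theorem radOf_eq_jacobson_smul (N : Submodule A P) : radOf N = Ring.jacobson A • N := by
  refine le_antisymm (span_le.mpr ?_) (smul_le.mpr fun r hr p hp ↦ subset_span ⟨r, ?_, p, hp, rfl⟩)
  · rintro _ ⟨r, hr, p, hp, rfl⟩
    exact smul_mem_smul (Ideal.jacobson_bot (R := A) ▸ hr) hp
  · exact (Ideal.jacobson_bot (R := A)).symm ▸ hr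

theorem radOf_le (N : Submodule A P) : radOf N ≤ N :=
  radOf_eq_jacobson_smul N ▸ smul_le_right

theorem radOf_mono {M N : Submodule A P} (h : M ≤ N) : radOf M ≤ radOf N := by
  simpa only [radOf_eq_jacobson_smul] using smul_mono le_rfl h

theorem radOf_sup (M N : Submodule A P) : radOf (M ⊔ N) = radOf M ⊔ radOf N := by
  simp only [radOf_eq_jacobson_smul, smul_sup]

theorem map_radOf (f : P →ₗ[A] P') (N : Submodule A P) : (radOf N).map f = radOf (N.map f) := by
  simp only [radOf_eq_jacobson_smul, map_smul'']

/-- Passing to a direct summand: elements of `rad(N) ⊔ C` lying in `N` lie in `rad(N)`. -/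
theorem radOf_sup_inf_le {N C : Submodule A P} (h : N ⊓ C = ⊥) :
    (radOf N ⊔ C) ⊓ N ≤ radOf N := by
  rw [sup_inf_assoc_of_le C (radOf_le N), inf_comm C N, h, sup_bot_eq]

theorem radOf_top_inf_le {N C : Submodule A P} (h : IsCompl N C) :
    radOf ⊤ ⊓ N ≤ radOf N := by
  rw [← h.sup_eq_top, radOf_sup]
  exact (inf_le_inf_right N (sup_le_sup_left (radOf_le C) _)).trans
    (radOf_sup_inf_le h.inf_eq_bot)

/-- Nakayama's lemma. -/
theorem eq_top_of_sup_radOf_eq_top [IsNoetherian A P] {L : Submodule A P}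
    (h : L ⊔ radOf ⊤ = ⊤) : L = ⊤ := by
  suffices (⊤ : Submodule A (P ⧸ L)) = ⊥ by
    rw [← ker_mkQ L, LinearMap.ker_eq_top]
    exact LinearMap.range_eq_bot.mp (by rw [range_mkQ, this])
  refine FG.eq_bot_of_le_jacobson_smul (IsNoetherian.noetherian ⊤) (le_of_eq ?_)
  have := congrArg (map L.mkQ) h
  rw [Submodule.map_sup, mkQ_map_self, bot_sup_eq, map_radOf, radOf_eq_jacobson_smul,
    Submodule.map_top, range_mkQ] at this
  exact this.symm

theorem le_radOf_top_of_superfluous [IsArtinianRing A] {D : Submodule A P}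
    (h : ∀ T, T ⊔ D = ⊤ → T = ⊤) : D ≤ radOf ⊤ := by
  rw [radOf_eq_jacobson_smul]
  set J : Submodule A P := Ring.jacobson A • ⊤
  have : IsSemisimpleModule A (P ⧸ J) := by
    have ht : Module.IsTorsionBySet A (P ⧸ J) (Ring.jacobson A) :=
      (Module.isTorsionBySet_quotient_iff _ _).mpr fun m r hr ↦ smul_mem_smul hr trivial
    let _ := ht.module
    exact (ht.semilinearMap.isSemisimpleModule_iff_of_bijective Function.bijective_id).2
      inferInstance
  obtain ⟨C, hC⟩ := exists_isCompl (D.map J.mkQ)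
  have hT := h (C.comap J.mkQ) (eq_top_iff.mpr fun x _ ↦ by
    obtain ⟨_, ⟨d, hd, rfl⟩, c, hc, hx⟩ := mem_sup.mp (hC.sup_eq_top.ge (mem_top (x := J.mkQ x)))
    refine mem_sup.mpr ⟨x - d, ?_, d, hd, sub_add_cancel x d⟩
    rw [mem_comap, map_sub, ← hx, add_sub_cancel_left]
    exact hc)
  have hC' : C = ⊤ := by
    rw [← map_comap_eq_of_surjective J.mkQ_surjective C, hT, Submodule.map_top, range_mkQ]
  have hD := hC.inf_eq_bot
  rw [hC', inf_top_eq] at hD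
  exact (LinearMap.le_ker_iff_map.mpr hD).trans (ker_mkQ J).le

/-- If `X` is projective and `X ≤ N ⊔ W`, the inclusion of `X` factors through `N` modulo `W`. -/
theorem exists_lift_modulo {X N W : Submodule A P} [Module.Projective A X] (h : X ≤ N ⊔ W) :
    ∃ g : X →ₗ[A] N, ∀ x, (g x : P) - x ∈ W := by
  obtain ⟨g, hg⟩ := Module.projective_lifting_property
    (LinearMap.coprod (inclusion (le_sup_left : N ≤ N ⊔ W)) (inclusion (le_sup_right : W ≤ N ⊔ W)))
    (inclusion h) (by
      rintro ⟨y, hy⟩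
      obtain ⟨n, hn, w, hw, rfl⟩ := mem_sup.mp hy
      exact ⟨(⟨n, hn⟩, ⟨w, hw⟩), rfl⟩)
  refine ⟨LinearMap.fst A N W ∘ₗ g, fun x ↦ ?_⟩
  have hx : ((g x).1 : P) + (g x).2 = x := congrArg Subtype.val (LinearMap.congr_fun hg x)
  rw [← hx]
  simp

theorem projective_of_isCompl [Module.Projective A P] {N C : Submodule A P} (h : IsCompl N C) :
    Module.Projective A N :=
  .of_split N.subtype (N.projectionOnto C h) (by ext; simp)

/-- A submodule `X` which is projective splits, for every `L`, as `N ⊕ C` with `C ≤ L` and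
`N ⊓ L ≤ rad(N)`: the summand `N` is a projective cover of `X ⧸ (X ⊓ L)`. -/
theorem exists_projectiveCover_summand [IsArtinianRing A] [IsArtinian A P] [IsNoetherian A P]
    (X L : Submodule A P) [Module.Projective A X] :
    ∃ N C : Submodule A P, N ⊓ C = ⊥ ∧ N ⊔ C = X ∧ C ≤ L ∧ L ⊓ N ≤ radOf N := by
  obtain ⟨N, ⟨hNX, hXN⟩, hmin⟩ := WellFounded.has_min (wellFounded_lt (α := Submodule A P))
    {N | N ≤ X ∧ X ≤ N ⊔ L} ⟨X, le_rfl, le_sup_left⟩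
  have hsup : ∀ T : Submodule A N, T ⊔ L.comap N.subtype = ⊤ → T = ⊤ := by
    intro T hT
    have hT' : N ≤ T.map N.subtype ⊔ L := by
      have := congrArg (map N.subtype) hT
      rw [Submodule.map_sup, map_comap_subtype, Submodule.map_top, range_subtype] at this
      exact this.ge.trans (sup_le_sup_left inf_le_right _)
    have hle := map_subtype_le N T
    have heq : T.map N.subtype = N := by
      by_contra hne
      exact hmin _ ⟨hle.trans hNX, hXN.trans (sup_le hT' le_sup_right)⟩ (lt_of_le_of_ne hle hne)
    apply map_injective_of_injective N.subtype_injective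
    rw [heq, Submodule.map_top, range_subtype]
  obtain ⟨g, hg⟩ := exists_lift_modulo hXN
  set e : N →ₗ[A] N := g ∘ₗ inclusion hNX
  have hsurj : Function.Surjective e := by
    refine LinearMap.range_eq_top.mp (hsup _ (eq_top_iff.mpr fun n _ ↦ ?_))
    refine mem_sup.mpr ⟨e n, ⟨n, rfl⟩, n - e n, ?_, by abel⟩
    simpa [e] using neg_mem (hg (inclusion hNX n))
  have hinj : Function.Injective e := IsNoetherian.injective_of_surjective_endomorphism e hsurj
  refine ⟨N, (LinearMap.ker g).map X.subtype, ?_, le_antisymm (sup_le hNX (map_subtype_le _ _)) ?_,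
    ?_, ?_⟩
  · rw [eq_bot_iff]
    rintro n ⟨hn, x, hx, rfl⟩
    have : (⟨x, hn⟩ : N) = 0 := hinj (by rw [map_zero]; exact hx)
    exact congrArg Subtype.val this
  · intro x hx
    obtain ⟨n, hn⟩ := hsurj (g ⟨x, hx⟩)
    refine mem_sup.mpr ⟨n, n.2, x - n, ⟨⟨x, hx⟩ - inclusion hNX n, ?_, rfl⟩, by abel⟩
    rw [SetLike.mem_coe, LinearMap.mem_ker, map_sub, sub_eq_zero]
    exact hn.symm
  · rintro _ ⟨x, hx, rfl⟩
    have := hg x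
    rw [LinearMap.mem_ker.mp hx] at this
    simpa using this
  · have := map_mono (f := N.subtype) (le_radOf_top_of_superfluous hsup)
    rwa [map_radOf, map_comap_subtype, Submodule.map_top, range_subtype, inf_comm] at this

theorem exists_surjective_of_sup_eq_sup [IsNoetherian A P] {N N' W : Submodule A P}
    [Module.Projective A N] (h : N ⊔ W = N' ⊔ W) (hW' : W ⊓ N' ≤ radOf N') :
    ∃ g : N →ₗ[A] N', Function.Surjective g := by
  obtain ⟨g, hg⟩ := exists_lift_modulo (le_sup_left.trans h.le)
  refine ⟨g, LinearMap.range_eq_top.mp (eq_top_of_sup_radOf_eq_top (eq_top_iff.mpr ?_))⟩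
  rintro ⟨n', hn'⟩ -
  obtain ⟨n, hn, w, hw, rfl⟩ := mem_sup.mp (h.ge (mem_sup_left hn'))
  refine mem_sup.mpr ⟨g ⟨n, hn⟩, ⟨_, rfl⟩, ⟨n + w, hn'⟩ - g ⟨n, hn⟩, ?_, by abel⟩
  have hmem : n + w - g ⟨n, hn⟩ ∈ radOf N' := by
    refine hW' ⟨?_, sub_mem hn' (g _).2⟩
    have := sub_mem hw (hg ⟨n, hn⟩)
    rwa [show w - (g ⟨n, hn⟩ - n) = n + w - g ⟨n, hn⟩ by abel] at this
  have : radOf N' = (radOf ⊤).map N'.subtype := by rw [map_radOf, Submodule.map_top, range_subtype]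
  rw [this] at hmem
  obtain ⟨y, hy, hyx⟩ := hmem
  exact (Subtype.ext hyx : y = ⟨n + w, hn'⟩ - g ⟨n, hn⟩) ▸ hy

/-- Uniqueness of projective covers: two projective submodules with the same image modulo `W`
and meeting `W` inside their radicals are isomorphic. -/
theorem nonempty_equiv_of_sup_eq_sup [IsNoetherian A P] {N N' W : Submodule A P}
    [Module.Projective A N] [Module.Projective A N'] (h : N ⊔ W = N' ⊔ W)
    (hW : W ⊓ N ≤ radOf N) (hW' : W ⊓ N' ≤ radOf N') : Nonempty (N ≃ₗ[A] N') := by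
  obtain ⟨g, hg⟩ := exists_surjective_of_sup_eq_sup h hW'
  obtain ⟨g', hg'⟩ := exists_surjective_of_sup_eq_sup h.symm hW
  have hinj := IsNoetherian.injective_of_surjective_endomorphism (g' ∘ₗ g) (hg'.comp hg)
  exact ⟨.ofBijective g ⟨Function.Injective.of_comp (f := g') hinj, hg⟩⟩

end Radical

namespace IsCanonDecomp

open Submodule

variable {A P₁ P₀ : Type*} [Ring A] [AddCommGroup P₁] [Module A P₁] [AddCommGroup P₀] [Module A P₀]
  {f : P₁ →ₗ[A] P₀} {Q₁ R Q : Submodule A P₁} {Q₀ R' : Submodule A P₀}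

theorem isCompl_right (h : IsCanonDecomp f Q₁ R Q Q₀ R') : IsCompl Q (Q₁ ⊔ R) := by
  obtain ⟨-, h2, h3, -⟩ := h
  exact (isCompl_iff.mpr ⟨disjoint_iff.mpr h2, codisjoint_iff.mpr h3⟩).symm

theorem isCompl_left (h : IsCanonDecomp f Q₁ R Q Q₀ R') : IsCompl Q₁ (R ⊔ Q) := by
  obtain ⟨h1, h2, h3, -⟩ := h
  refine isCompl_iff.mpr ⟨?_, codisjoint_iff.mpr (by rw [← sup_assoc, h3])⟩
  exact Disjoint.disjoint_sup_right_of_disjoint_sup_left (disjoint_iff.mpr h1) (disjoint_iff.mpr h2)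

theorem isCompl_target (h : IsCanonDecomp f Q₁ R Q Q₀ R') : IsCompl Q₀ R' := by
  obtain ⟨-, -, -, h4, h5, -⟩ := h
  exact isCompl_iff.mpr ⟨disjoint_iff.mpr h4, codisjoint_iff.mpr h5⟩

theorem nonempty_equiv (h : IsCanonDecomp f Q₁ R Q Q₀ R') : Nonempty (R ≃ₗ[A] R') := by
  obtain ⟨-, -, -, -, -, -, rfl, h8, -⟩ := h
  refine ⟨.ofBijective (f.submoduleMap R) ⟨?_, f.submoduleMap_surjective R⟩⟩
  refine (injective_iff_map_eq_zero _).mpr fun x hx ↦ Subtype.ext (h8 x x.2 ?_)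
  exact congrArg Subtype.val hx

theorem range_eq (h : IsCanonDecomp f Q₁ R Q Q₀ R') : LinearMap.range f = Q₁.map f ⊔ R' := by
  obtain ⟨-, -, h3, -, -, -, h7, -, h9, -⟩ := h
  rw [LinearMap.range_eq_map, ← h3, Submodule.map_sup, Submodule.map_sup, h7,
    LinearMap.le_ker_iff_map.mp h9, sup_bot_eq]

theorem ker_le (h : IsCanonDecomp f Q₁ R Q Q₀ R') : LinearMap.ker f ≤ radOf Q₁ ⊔ Q := by
  obtain ⟨-, -, h3, h4, -, h6, h7, h8, h9, -, h11⟩ := h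
  intro x hx
  obtain ⟨y, hy, q, hq, rfl⟩ := mem_sup.mp (h3.ge (mem_top (x := x)))
  obtain ⟨a, ha, r, hr, rfl⟩ := mem_sup.mp hy
  have hx' : f a + f r = 0 := by
    have hq0 : f q = 0 := h9 hq
    simpa [hq0] using hx
  have hr0 : f r = 0 := by
    have : f r ∈ Q₀ ⊓ R' := ⟨?_, h7.le (mem_map_of_mem hr)⟩
    · simpa [h4] using this
    · rw [eq_neg_of_add_eq_zero_right hx']
      exact neg_mem (h6 (mem_map_of_mem ha))
  rw [hr0, add_zero] at hx'
  rw [h8 r hr hr0, add_zero]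
  exact add_mem (mem_sup_left (h11 ⟨hx', ha⟩)) (mem_sup_right hq)

theorem sup_range_eq (h : IsCanonDecomp f Q₁ R Q Q₀ R') :
    Q₀ ⊔ (LinearMap.range f ⊔ radOf ⊤) = ⊤ := by
  rw [h.range_eq, eq_top_iff, ← h.isCompl_target.sup_eq_top]
  exact sup_le_sup_left (le_sup_right.trans le_sup_left) _

theorem range_inf_le (h : IsCanonDecomp f Q₁ R Q Q₀ R') :
    (LinearMap.range f ⊔ radOf ⊤) ⊓ Q₀ ≤ radOf Q₀ := by
  refine (inf_le_inf_right _ ?_).trans (radOf_sup_inf_le h.isCompl_target.inf_eq_bot)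
  rw [h.range_eq, ← h.isCompl_target.sup_eq_top, radOf_sup]
  obtain ⟨-, -, -, -, -, -, -, -, -, h10, -⟩ := h
  exact sup_le (sup_le_sup_right h10 _) (sup_le_sup_left (radOf_le _) _)

theorem sup_radOf_target_eq (h : IsCanonDecomp f Q₁ R Q Q₀ R') :
    R' ⊔ radOf ⊤ = LinearMap.range f ⊔ radOf ⊤ := by
  rw [h.range_eq]
  obtain ⟨-, -, -, -, -, -, -, -, -, h10, -⟩ := h
  exact le_antisymm (sup_le_sup_right le_sup_right _)
    (sup_le (sup_le ((h10.trans (radOf_mono le_top)).trans le_sup_right) le_sup_left) le_sup_right)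

theorem sup_radOf_eq (h : IsCanonDecomp f Q₁ R Q Q₀ R') :
    Q ⊔ radOf ⊤ = LinearMap.ker f ⊔ radOf ⊤ := by
  have hk := h.ker_le
  obtain ⟨-, -, -, -, -, -, -, -, h9, -⟩ := h
  refine le_antisymm (sup_le_sup_right h9 _) (sup_le (hk.trans (sup_le ?_ le_sup_left)) le_sup_right)
  exact (radOf_mono le_top).trans le_sup_right

theorem sup_ker_eq (h : IsCanonDecomp f Q₁ R Q Q₀ R') :
    Q₁ ⊔ (LinearMap.ker f ⊔ radOf ⊤) = (radOf ⊤).comap f ⊔ (LinearMap.ker f ⊔ radOf ⊤) := by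
  have hc := radOf_top_inf_le h.isCompl_target.symm
  obtain ⟨-, -, h3, -, -, -, h7, h8, h9, h10, -⟩ := h
  refine le_antisymm (sup_le_sup_right (map_le_iff_le_comap.mp
    (h10.trans (radOf_mono le_top))) _) (sup_le (fun x hx ↦ ?_) le_sup_right)
  obtain ⟨y, hy, q, hq, rfl⟩ := mem_sup.mp (h3.ge (mem_top (x := x)))
  obtain ⟨a, ha, r, hr, rfl⟩ := mem_sup.mp hy
  have hfr : f r ∈ radOf R' := by
    refine hc ⟨?_, h7.le (mem_map_of_mem hr)⟩
    have hq0 : f q = 0 := h9 hq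
    have hfa : f a ∈ radOf (⊤ : Submodule A P₀) := radOf_mono le_top (h10 (mem_map_of_mem ha))
    have hx' : f a + f r ∈ radOf (⊤ : Submodule A P₀) := by simpa [hq0] using hx
    exact (add_mem_cancel_left hfa).mp hx'
  rw [← h7, ← map_radOf] at hfr
  obtain ⟨s, hs, hsr⟩ := hfr
  have : r = s := sub_eq_zero.mp (h8 _ (sub_mem hr (radOf_le R hs)) (by rw [map_sub, hsr, sub_self]))
  subst this
  exact add_mem (add_mem (mem_sup_left ha)
    (mem_sup_right (mem_sup_right (radOf_mono le_top hs)))) (mem_sup_right (mem_sup_left (h9 hq)))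

theorem ker_inf_le (h : IsCanonDecomp f Q₁ R Q Q₀ R') :
    (LinearMap.ker f ⊔ radOf ⊤) ⊓ Q₁ ≤ radOf Q₁ := by
  refine (inf_le_inf_right _ ?_).trans (radOf_sup_inf_le h.isCompl_left.inf_eq_bot)
  refine sup_le (h.ker_le.trans (sup_le_sup_left le_sup_right _)) ?_
  rw [← h.isCompl_left.sup_eq_top, radOf_sup]
  exact sup_le_sup_left (radOf_le _) _

theorem exists_of_projective [IsArtinianRing A] [IsArtinian A P₁] [IsNoetherian A P₁]
    [IsArtinian A P₀] [IsNoetherian A P₀] [Module.Projective A P₁] [Module.Projective A P₀]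
    (f : P₁ →ₗ[A] P₀) :
    ∃ (Q₁ R Q : Submodule A P₁) (Q₀ R' : Submodule A P₀), IsCanonDecomp f Q₁ R Q Q₀ R' := by
  have : Module.Projective A (⊤ : Submodule A P₀) := .of_equiv topEquiv.symm
  obtain ⟨Q₀, R', h4, h5, hR', hQ₀⟩ := exists_projectiveCover_summand ⊤ (LinearMap.range f)
  have hcompl : IsCompl Q₀ R' := isCompl_iff.mpr ⟨disjoint_iff.mpr h4, codisjoint_iff.mpr h5⟩
  have := projective_of_isCompl hcompl.symm
  obtain ⟨s, hs⟩ := Module.projective_lifting_property f.rangeRestrict (inclusion hR')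
    f.surjective_rangeRestrict
  have hfs (r : R') : f (s r) = r := congrArg Subtype.val (LinearMap.congr_fun hs r)
  have hinf : Q₀.comap f ⊓ LinearMap.range s = ⊥ := by
    rw [eq_bot_iff]
    rintro _ ⟨hx, r, rfl⟩
    have hr : (r : P₀) ∈ Q₀ ⊓ R' := ⟨hfs r ▸ hx, r.2⟩
    rw [h4, mem_bot, ZeroMemClass.coe_eq_zero] at hr
    simp [hr]
  have hsup : Q₀.comap f ⊔ LinearMap.range s = ⊤ := by
    refine eq_top_iff.mpr fun x _ ↦ ?_
    obtain ⟨q, hq, r, hr, hqr⟩ := mem_sup.mp (h5.ge (mem_top (x := f x)))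
    refine mem_sup.mpr ⟨x - s ⟨r, hr⟩, ?_, s ⟨r, hr⟩, ⟨_, rfl⟩, by abel⟩
    rw [mem_comap, map_sub, hfs, ← hqr]
    simpa using hq
  have := projective_of_isCompl
    (isCompl_iff.mpr ⟨disjoint_iff.mpr hinf, codisjoint_iff.mpr hsup⟩)
  obtain ⟨Q₁, Q, h1, h2, hQ, hQ₁⟩ :=
    exists_projectiveCover_summand (Q₀.comap f) (LinearMap.ker f)
  have hle : Q₁.map f ≤ Q₀ := map_le_iff_le_comap.mpr (h2 ▸ le_sup_left)
  have hd : Disjoint (LinearMap.range s) (Q₁ ⊔ Q) := by rw [h2, disjoint_comm, disjoint_iff, hinf]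
  refine ⟨Q₁, LinearMap.range s, Q, Q₀, R', ?_, ?_, ?_, h4, h5, hle, ?_, ?_, hQ,
    (le_inf LinearMap.map_le_range hle).trans hQ₀, hQ₁⟩
  · exact (hd.mono_right le_sup_left).symm.eq_bot
  · exact ((disjoint_iff.mpr h1).symm.disjoint_sup_right_of_disjoint_sup_left
      (by rw [sup_comm]; exact hd.symm)).symm.eq_bot
  · rw [sup_right_comm, h2, hsup]
  · rw [← LinearMap.range_comp, show f ∘ₗ s = R'.subtype from LinearMap.ext hfs, range_subtype]
  · rintro _ ⟨r, rfl⟩ hr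
    rw [hfs, ZeroMemClass.coe_eq_zero] at hr
    rw [hr, map_zero]

end IsCanonDecomp

theorem stmt13 {K A : Type*} [Field K] [IsAlgClosed K] [Ring A] [Algebra K A]
    [FiniteDimensional K A]
    {P₁ P₀ : Type*}
    [AddCommGroup P₁] [Module A P₁] [Module K P₁] [IsScalarTower K A P₁] [FiniteDimensional K P₁]
    [AddCommGroup P₀] [Module A P₀] [Module K P₀] [IsScalarTower K A P₀] [FiniteDimensional K P₀]
    (hP₁proj : Module.Projective A P₁) (hP₀proj : Module.Projective A P₀)
    (f : P₁ →ₗ[A] P₀) :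
    (∃ (Q₁ R Q : Submodule A P₁) (Q₀ R' : Submodule A P₀),
      IsCanonDecomp f Q₁ R Q Q₀ R') ∧
    (∀ (Q₁ R Q : Submodule A P₁) (Q₀ R' : Submodule A P₀)
       (Q₁' R₂ Q' : Submodule A P₁) (Q₀' R₂' : Submodule A P₀),
      IsCanonDecomp f Q₁ R Q Q₀ R' → IsCanonDecomp f Q₁' R₂ Q' Q₀' R₂' →
      Nonempty (Q₁ ≃ₗ[A] Q₁') ∧ Nonempty (Q₀ ≃ₗ[A] Q₀') ∧
      Nonempty (R ≃ₗ[A] R₂) ∧ Nonempty (Q ≃ₗ[A] Q')) := by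
  have := hP₁proj
  have := hP₀proj
  have : IsArtinianRing A := .of_finite K A
  have : IsArtinian A P₁ := isArtinian_of_tower K inferInstance
  have : IsArtinian A P₀ := isArtinian_of_tower K inferInstance
  have : IsNoetherian A P₁ := isNoetherian_of_tower K inferInstance
  have : IsNoetherian A P₀ := isNoetherian_of_tower K inferInstance
  refine ⟨IsCanonDecomp.exists_of_projective f, fun Q₁ R Q Q₀ R' Q₁' R₂ Q' Q₀' R₂' h h' ↦ ?_⟩
  have := projective_of_isCompl h.isCompl_left
  have := projective_of_isCompl h'.isCompl_left
  have := projective_of_isCompl h.isCompl_right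
  have := projective_of_isCompl h'.isCompl_right
  have := projective_of_isCompl h.isCompl_target
  have := projective_of_isCompl h'.isCompl_target
  have := projective_of_isCompl h.isCompl_target.symm
  have := projective_of_isCompl h'.isCompl_target.symm
  refine ⟨nonempty_equiv_of_sup_eq_sup (h.sup_ker_eq.trans h'.sup_ker_eq.symm)
      h.ker_inf_le h'.ker_inf_le,
    nonempty_equiv_of_sup_eq_sup (h.sup_range_eq.trans h'.sup_range_eq.symm)
      h.range_inf_le h'.range_inf_le, ?_,
    nonempty_equiv_of_sup_eq_sup (h.sup_radOf_eq.trans h'.sup_radOf_eq.symm)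
      (radOf_top_inf_le h.isCompl_right) (radOf_top_inf_le h'.isCompl_right)⟩
  obtain ⟨e⟩ := h.nonempty_equiv
  obtain ⟨e'⟩ := h'.nonempty_equiv
  obtain ⟨e₀⟩ := nonempty_equiv_of_sup_eq_sup
    (h.sup_radOf_target_eq.trans h'.sup_radOf_target_eq.symm)
    (radOf_top_inf_le h.isCompl_target.symm) (radOf_top_inf_le h'.isCompl_target.symm)
  exact ⟨e.trans (e₀.trans e'.symm)⟩
end

section
/- Let P_1 and P_0 be finite-dimensional projective A-modules and let f : P_1 → P_0 be a homomorphism. Suppose P_1 = Q_1 ⊕ R ⊕ Q and P_0 = Q_0 ⊕ R' are direct sum decompositions such that f(Q_1) ⊆ Q_0, f restricts to an isomorphism R → R', f(Q) = 0, and the restriction f' : Q_1 → Q_0 satisfies Im(f') ⊆ rad(Q_0) and Ker(f') ⊆ rad(Q_1). Then rank(f) = r(P_1, P_0) if and only if rank(f') = r(Q_1, Q_0) and Hom_A(Q, Coker(f)) = 0. -/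
theorem finite_setOf_finrank_range_add_smul_lt {K V W : Type*} [Field K] [AddCommGroup V]
    [Module K V] [AddCommGroup W] [Module K W] [FiniteDimensional K W] (a b : V →ₗ[K] W) :
    {t : K | Module.finrank K (LinearMap.range (a + t • b)) <
      Module.finrank K (LinearMap.range a)}.Finite := by
  obtain ⟨u, hu⟩ := LinearMap.exists_rightInverse_of_surjective a.rangeRestrict
    a.range_rangeRestrict
  obtain ⟨p, hp⟩ := LinearMap.exists_leftInverse_of_injective (LinearMap.range a).subtype
    (Submodule.ker_subtype _)
  let c : Module.End K (LinearMap.range a) := p ∘ₗ b ∘ₗ u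
  have hc : ∀ (t : K) x, p ((a + t • b) (u x)) = x + t • c x := by
    intro t x
    have h1 : a (u x) = x := congrArg Subtype.val (LinearMap.congr_fun hu x)
    have h2 : p x = x := LinearMap.congr_fun hp x
    simp [c, h1, h2]
  refine ((Module.End.finite_hasEigenvalue c).image (fun x => -x⁻¹)).subset ?_
  intro t ht
  by_contra hne
  rw [Set.mem_ofPred_eq] at ht
  refine absurd ht (not_lt.mpr ?_)
  have hinj : Function.Injective (p ∘ₗ (a + t • b) ∘ₗ u) := by
    rw [injective_iff_map_eq_zero]
    intro x hx
    by_contra hx0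
    have hx' : x + t • c x = 0 := by rw [← hc]; exact hx
    have ht0 : t ≠ 0 := by
      rintro rfl
      simp [hx0] at hx'
    refine hne ⟨-t⁻¹, ?_, by simp⟩
    refine Module.End.hasEigenvalue_of_hasEigenvector (x := x)
      ⟨Module.End.mem_eigenspace_iff.mpr ?_, hx0⟩
    have h3 : t • c x = -x := by rw [eq_neg_iff_add_eq_zero, add_comm]; exact hx'
    rw [neg_smul, ← smul_neg, ← h3, smul_smul, inv_mul_cancel₀ ht0, one_smul]
  have hinj' : Function.Injective ((a + t • b).rangeRestrict ∘ₗ u) := by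
    intro x y hxy
    apply hinj
    exact congrArg p (congrArg Subtype.val hxy)
  exact LinearMap.finrank_le_finrank_of_injective hinj'

section Rank

variable {K A M N : Type*} [Field K] [Ring A] [Algebra K A]
  [AddCommGroup M] [Module A M] [AddCommGroup N] [Module A N] [Module K N] [IsScalarTower K A N]

theorem rk_eq_finrank_range_restrictScalars [Module K M] [IsScalarTower K A M] (f : M →ₗ[A] N) :
    rk K f = Module.finrank K (LinearMap.range (f.restrictScalars K)) :=
  rfl

theorem rk_smul {t : K} (ht : t ≠ 0) (f : M →ₗ[A] N) : rk K (t • f) = rk K f := by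
  have : LinearMap.range (t • f) = LinearMap.range f := by
    ext y
    simp only [LinearMap.mem_range, LinearMap.smul_apply]
    have hs : ∀ (s : K) (x : M), s • f x = f (algebraMap K A s • x) := fun s x => by
      rw [map_smul, algebraMap_smul]
    constructor
    · rintro ⟨x, rfl⟩
      exact ⟨_, (hs t x).symm⟩
    · rintro ⟨x, rfl⟩
      exact ⟨algebraMap K A t⁻¹ • x, by rw [← hs, smul_smul, mul_inv_cancel₀ ht, one_smul]⟩
  rw [rk, this, rk]

theorem rmax_le {n : ℕ} (h : ∀ f : M →ₗ[A] N, rk K f ≤ n) : rmax K A M N ≤ n := by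
  refine csSup_le ⟨_, 0, rfl⟩ ?_
  rintro _ ⟨g, rfl⟩
  exact h g

theorem finiteDimensional_of_isScalarTower [FiniteDimensional K N] (s : Submodule A N) :
    FiniteDimensional K s :=
  inferInstanceAs (FiniteDimensional K (s.restrictScalars K))

theorem finrank_sup_add_finrank_inf_of_isScalarTower [FiniteDimensional K N]
    (s t : Submodule A N) :
    Module.finrank K ↥(s ⊔ t) + Module.finrank K ↥(s ⊓ t) =
      Module.finrank K s + Module.finrank K t := by
  have := Submodule.finrank_sup_add_finrank_inf_eq (s.restrictScalars K) (t.restrictScalars K)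
  rwa [← Submodule.restrictScalars_sup, ← Submodule.restrictScalars_inf] at this

theorem finrank_le_finrank_of_le_of_isScalarTower [FiniteDimensional K N]
    {s t : Submodule A N} (h : s ≤ t) : Module.finrank K s ≤ Module.finrank K t :=
  Submodule.finrank_mono (s := s.restrictScalars K) (t := t.restrictScalars K) h

theorem finrank_map_subtype_range {Q₀ : Submodule A N} (h : M →ₗ[A] Q₀) :
    Module.finrank K ((LinearMap.range h).map Q₀.subtype) = rk K h :=
  (((Submodule.equivMapOfInjective Q₀.subtype Q₀.injective_subtype
    (LinearMap.range h)).restrictScalars K).finrank_eq).symm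

theorem rk_eq_rk_add_finrank [FiniteDimensional K N] {Q₁ R Q : Submodule A M}
    {Q₀ R' : Submodule A N} (htop : Q₁ ⊔ R ⊔ Q = ⊤) (hdisj : Q₀ ⊓ R' = ⊥)
    {g : M →ₗ[A] N} {h : Q₁ →ₗ[A] Q₀} (hgh : ∀ x : Q₁, g x = h x)
    (hgR : R.map g = R') (hgQ : Q ≤ LinearMap.ker g) :
    rk K g = rk K h + Module.finrank K R' := by
  have hQ₁ : Q₁.map g = (LinearMap.range h).map Q₀.subtype := by
    have : g ∘ₗ Q₁.subtype = Q₀.subtype ∘ₗ h := LinearMap.ext hgh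
    rw [← LinearMap.range_comp, ← this, LinearMap.range_comp, Submodule.range_subtype]
  have hr : LinearMap.range g = (LinearMap.range h).map Q₀.subtype ⊔ R' := by
    rw [LinearMap.range_eq_map, ← htop, Submodule.map_sup, Submodule.map_sup, hgR, hQ₁,
      LinearMap.le_ker_iff_map.mp hgQ, sup_bot_eq]
  have hd : (LinearMap.range h).map Q₀.subtype ⊓ R' = ⊥ :=
    eq_bot_iff.mpr ((inf_le_inf_right _ (Submodule.map_subtype_le _ _)).trans hdisj.le)
  have := finrank_sup_add_finrank_inf_of_isScalarTower (K := K)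
    ((LinearMap.range h).map Q₀.subtype) R'
  rw [hd, ← hr, finrank_map_subtype_range,
    Module.finrank_zero_of_subsingleton (M := (⊥ : Submodule A N)), add_zero] at this
  exact this

theorem finite_setOf_rk_add_smul_lt [Module K M] [IsScalarTower K A M] [FiniteDimensional K N]
    (f g : M →ₗ[A] N) : {t : K | rk K (f + t • g) < rk K f}.Finite :=
  finite_setOf_finrank_range_add_smul_lt (f.restrictScalars K) (g.restrictScalars K)

/-- If the `R → R'` block of `k` is injective and `dim R = dim R'`, eliminating it (Schur
complement) bounds the rank of `k` on `Q₁ ⊔ R`. -/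
theorem finrank_map_sup_le [FiniteDimensional K N] [Module K M] [IsScalarTower K A M]
    [FiniteDimensional K M] {Q₁ R : Submodule A M} {Q₀ R' : Submodule A N} (hc : IsCompl R' Q₀)
    (e : R ≃ₗ[A] R') {k : M →ₗ[A] N}
    (hk : Function.Injective (R'.projectionOnto Q₀ hc ∘ₗ k ∘ₗ R.subtype)) :
    Module.finrank K ((Q₁ ⊔ R).map k) ≤ rmax K A Q₁ Q₀ + Module.finrank K R' := by
  have := finiteDimensional_of_isScalarTower (K := K) R
  have := finiteDimensional_of_isScalarTower (K := K) R'
  have := finiteDimensional_of_isScalarTower (K := K) Q₀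
  have heq : Module.finrank K R = Module.finrank K R' := (e.restrictScalars K).finrank_eq
  have hsurj : Function.Surjective (R'.projectionOnto Q₀ hc ∘ₗ k ∘ₗ R.subtype) :=
    (LinearMap.injective_iff_surjective_of_finrank_eq_finrank
      (f := (R'.projectionOnto Q₀ hc ∘ₗ k ∘ₗ R.subtype).restrictScalars K) heq).mp hk
  let c := LinearEquiv.ofBijective _ ⟨hk, hsurj⟩
  have hcs : ∀ y, R'.projectionOnto Q₀ hc (k (c.symm y)) = y := c.apply_symm_apply
  let s : Q₁ →ₗ[A] R := c.symm.toLinearMap ∘ₗ R'.projectionOnto Q₀ hc ∘ₗ k ∘ₗ Q₁.subtype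
  let h : Q₁ →ₗ[A] Q₀ := (k ∘ₗ Q₁.subtype - k ∘ₗ R.subtype ∘ₗ s).codRestrict Q₀ fun x => by
    rw [← Submodule.projectionOnto_apply_eq_zero_iff hc]
    simp [s, hcs]
  have hle : (Q₁ ⊔ R).map k ≤ (LinearMap.range h).map Q₀.subtype ⊔ R.map k := by
    rw [Submodule.map_sup, sup_le_iff]
    refine ⟨?_, le_sup_right⟩
    rintro _ ⟨x, hx, rfl⟩
    refine Submodule.mem_sup.mpr ⟨h ⟨x, hx⟩, ⟨_, ⟨_, rfl⟩, rfl⟩, k (s ⟨x, hx⟩),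
      ⟨_, (s ⟨x, hx⟩).2, rfl⟩, ?_⟩
    simp [h]
  have h1 := finrank_le_finrank_of_le_of_isScalarTower (K := K) hle
  have h2 := finrank_sup_add_finrank_inf_of_isScalarTower (K := K)
    ((LinearMap.range h).map Q₀.subtype) (R.map k)
  have h3 : Module.finrank K (R.map k) ≤ Module.finrank K R :=
    Submodule.finrank_map_le (k.restrictScalars K) (R.restrictScalars K)
  have h4 := rk_le_rmax (K := K) h
  rw [finrank_map_subtype_range] at h2
  omega

end Rank

theorem finite_moduleHom (K A M N : Type*) [Field K] [Ring A] [Algebra K A]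
    [AddCommGroup M] [Module A M] [Module K M] [IsScalarTower K A M] [FiniteDimensional K M]
    [AddCommGroup N] [Module A N] [Module K N] [IsScalarTower K A N] [FiniteDimensional K N] :
    FiniteDimensional K (M →ₗ[A] N) :=
  Module.Finite.of_injective (LinearMap.restrictScalarsₗ K A M N K)
    (LinearMap.restrictScalars_injective K)

theorem isCompl_of_sup_sup_eq_top {A M : Type*} [Ring A] [AddCommGroup M] [Module A M]
    {Q₁ R Q : Submodule A M} (h₁ : Q₁ ⊓ R = ⊥) (h₂ : (Q₁ ⊔ R) ⊓ Q = ⊥) (h₃ : Q₁ ⊔ R ⊔ Q = ⊤) :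
    IsCompl Q₁ (R ⊔ Q) :=
  ⟨(disjoint_iff.mpr h₁).disjoint_sup_right_of_disjoint_sup_left (disjoint_iff.mpr h₂),
    codisjoint_iff.mpr (by rw [← sup_assoc, h₃])⟩

theorem projective_of_isCompl_s14 {A M : Type*} [Ring A] [AddCommGroup M] [Module A M]
    [Module.Projective A M] {p q : Submodule A M} (h : IsCompl p q) : Module.Projective A p :=
  Module.Projective.of_split p.subtype (p.projectionOnto q h) (p.projectionOnto_comp_subtype h)

theorem stmt14 {K A : Type*} [Field K] [IsAlgClosed K] [Ring A] [Algebra K A]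
    [FiniteDimensional K A]
    {P₁ P₀ : Type*}
    [AddCommGroup P₁] [Module A P₁] [Module K P₁] [IsScalarTower K A P₁] [FiniteDimensional K P₁]
    [AddCommGroup P₀] [Module A P₀] [Module K P₀] [IsScalarTower K A P₀] [FiniteDimensional K P₀]
    (hP₁proj : Module.Projective A P₁) (hP₀proj : Module.Projective A P₀)
    (f : P₁ →ₗ[A] P₀)
    (Q₁ R Q : Submodule A P₁) (Q₀ R' : Submodule A P₀)
    -- `P₁ = Q₁ ⊕ R ⊕ Q` internally
    (h₁ : Q₁ ⊓ R = ⊥) (h₂ : (Q₁ ⊔ R) ⊓ Q = ⊥) (h₃ : Q₁ ⊔ R ⊔ Q = ⊤)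
    -- `P₀ = Q₀ ⊕ R'` internally
    (h₄ : Q₀ ⊓ R' = ⊥) (h₅ : Q₀ ⊔ R' = ⊤)
    -- `f(Q₁) ⊆ Q₀`
    (hmap : ∀ x ∈ Q₁, f x ∈ Q₀)
    -- `f` restricts to an isomorphism `R → R'`
    (hR : Submodule.map f R = R') (hRinj : ∀ x ∈ R, f x = 0 → x = 0)
    -- `f(Q) = 0`
    (hQ : Q ≤ LinearMap.ker f)
    -- the restriction `f' : Q₁ → Q₀` satisfies `Im(f') ⊆ rad(Q₀)` and `Ker(f') ⊆ rad(Q₁)`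
    (hrad₀ : Submodule.map f Q₁ ≤ radOf Q₀)
    (hrad₁ : LinearMap.ker f ⊓ Q₁ ≤ radOf Q₁) :
    rk K f = rmax K A P₁ P₀ ↔
      (rk K (f.restrict hmap) = rmax K A Q₁ Q₀ ∧
        ∀ φ : Q →ₗ[A] (P₀ ⧸ LinearMap.range f), φ = 0) := by
  have := finiteDimensional_of_isScalarTower (K := K) Q₀
  have := finiteDimensional_of_isScalarTower (K := K) Q
  have := finiteDimensional_of_isScalarTower (K := K) R
  have := finiteDimensional_of_isScalarTower (K := K) R'
  have := finiteDimensional_of_isScalarTower (K := K) (Q₁ ⊔ R)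
  have hc : IsCompl Q₁ (R ⊔ Q) := isCompl_of_sup_sup_eq_top h₁ h₂ h₃
  have hcQ : IsCompl Q (Q₁ ⊔ R) :=
    (IsCompl.of_eq h₂ h₃).symm
  have hc₀ : IsCompl R' Q₀ := (IsCompl.of_eq h₄ h₅).symm
  have : Module.Projective A Q := projective_of_isCompl_s14 hcQ
  have hf : rk K f = rk K (f.restrict hmap) + Module.finrank K R' :=
    rk_eq_rk_add_finrank h₃ h₄ (fun _ => rfl) hR hQ
  constructor
  · intro hmax
    constructor
    · refine le_antisymm (rk_le_rmax _) (rmax_le fun h => ?_)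
      let g : P₁ →ₗ[A] P₀ := LinearMap.ofIsCompl hc (Q₀.subtype ∘ₗ h) (f ∘ₗ (R ⊔ Q).subtype)
      have hgf : ∀ x ∈ R ⊔ Q, g x = f x := fun x hx =>
        LinearMap.ofIsCompl_apply_right hc (⟨x, hx⟩ : ↥(R ⊔ Q))
      have hgR : R.map g = R' := by
        rw [← hR]
        exact SetLike.coe_injective
          (Set.image_congr fun x hx => hgf x (Submodule.mem_sup_left hx))
      have hgQ : Q ≤ LinearMap.ker g := fun x hx =>
        (hgf x (Submodule.mem_sup_right hx)).trans (hQ hx)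
      have hg : rk K g = rk K h + Module.finrank K R' :=
        rk_eq_rk_add_finrank h₃ h₄ (fun x => LinearMap.ofIsCompl_apply_left hc x) hgR hgQ
      have := rk_le_rmax (K := K) g
      omega
    · intro φ
      obtain ⟨ψ, hψ⟩ := Module.projective_lifting_property (LinearMap.range f).mkQ φ
        (Submodule.mkQ_surjective _)
      let g : P₁ →ₗ[A] P₀ := LinearMap.ofIsCompl hcQ ψ (f ∘ₗ (Q₁ ⊔ R).subtype)
      have hle : LinearMap.range f ≤ LinearMap.range g := by
        rw [LinearMap.range_eq_map f, ← h₃, Submodule.map_sup, LinearMap.le_ker_iff_map.mp hQ,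
          sup_bot_eq]
        rintro _ ⟨x, hx, rfl⟩
        exact ⟨x, LinearMap.ofIsCompl_apply_right hcQ (⟨x, hx⟩ : ↥(Q₁ ⊔ R))⟩
      have heq : (LinearMap.range f).restrictScalars K = (LinearMap.range g).restrictScalars K :=
        Submodule.eq_of_le_of_finrank_le hle ((rk_le_rmax g).trans_eq hmax.symm)
      ext q
      rw [← hψ, LinearMap.comp_apply, Submodule.mkQ_apply, LinearMap.zero_apply,
        Submodule.Quotient.mk_eq_zero, ← Submodule.restrictScalars_mem K, heq]
      exact ⟨q, LinearMap.ofIsCompl_apply_left hcQ q⟩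
  · rintro ⟨hmax, hhom⟩
    refine le_antisymm (rk_le_rmax _) (rmax_le fun g => ?_)
    let e : R ≃ₗ[A] R' := LinearEquiv.ofBijective
      (f.restrict fun x hx => hR ▸ Submodule.mem_map_of_mem hx)
      ⟨(injective_iff_map_eq_zero _).mpr fun x hx =>
          Subtype.ext (hRinj x x.2 (congrArg Subtype.val hx)),
        fun ⟨y, hy⟩ => by
          obtain ⟨x, hx, rfl⟩ := hR.symm ▸ hy
          exact ⟨⟨x, hx⟩, rfl⟩⟩
    -- the block `R → R'` and the action on `Hom(Q, -)`, as `K`-linear functions of the map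
    let blk (k : P₁ →ₗ[A] P₀) : R →ₗ[A] R' := R'.projectionOnto Q₀ hc₀ ∘ₗ k ∘ₗ R.subtype
    let act (k : P₁ →ₗ[A] P₀) : (Q →ₗ[A] ↥(Q₁ ⊔ R)) →ₗ[K] (Q →ₗ[A] P₀) :=
      { toFun := fun u => (k ∘ₗ (Q₁ ⊔ R).subtype) ∘ₗ u
        map_add' := fun u v => LinearMap.comp_add _ _ _
        map_smul' := fun c u => LinearMap.ext fun x => by
          simp }
    have := finite_moduleHom K A Q P₀
    have hbf : Function.Injective (blk f) := by
      rw [injective_iff_map_eq_zero]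
      intro x hx
      have hx' : f x ∈ R' := hR ▸ Submodule.mem_map_of_mem x.2
      have h0 := (Submodule.projectionOnto_apply_of_mem_left hc₀ hx').symm.trans hx
      exact Subtype.ext (hRinj x x.2 (congrArg Subtype.val h0))
    have hactf : Function.Surjective (act f) := by
      intro w
      have hr : LinearMap.range (f ∘ₗ (Q₁ ⊔ R).subtype) = LinearMap.range f := by
        rw [LinearMap.range_comp, Submodule.range_subtype, LinearMap.range_eq_map f, ← h₃,
          Submodule.map_sup _ Q, LinearMap.le_ker_iff_map.mp hQ, sup_bot_eq]
      have hw : ∀ q, w q ∈ LinearMap.range (f ∘ₗ (Q₁ ⊔ R).subtype) := fun q => by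
        rw [hr, ← Submodule.Quotient.mk_eq_zero]
        exact LinearMap.congr_fun (hhom ((LinearMap.range f).mkQ ∘ₗ w)) q
      obtain ⟨u, hu⟩ := Module.projective_lifting_property
        (f ∘ₗ (Q₁ ⊔ R).subtype).rangeRestrict (w.codRestrict _ hw)
        (LinearMap.surjective_rangeRestrict _)
      exact ⟨u, LinearMap.ext fun q => congrArg Subtype.val (LinearMap.congr_fun hu q)⟩
    have hfin₁ := finite_setOf_rk_add_smul_lt (K := K) (blk f) (blk g)
    have hfin₂ := finite_setOf_finrank_range_add_smul_lt (act f) (act g)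
    have hfin₃ := (finite_setOf_rk_add_smul_lt (K := K) g f).image (·⁻¹)
    obtain ⟨t, ht⟩ := (((hfin₁.union hfin₂).union hfin₃).union
      (Set.finite_singleton 0)).infinite_compl.nonempty
    simp only [Set.mem_compl_iff, Set.mem_union, not_or, Set.mem_ofPred_eq, not_lt,
      Set.mem_singleton_iff] at ht
    obtain ⟨⟨⟨ht₁, ht₂⟩, ht₃⟩, ht0⟩ := ht
    have hk₁ : Function.Injective (blk (f + t • g)) := by
      have hadd : blk (f + t • g) = blk f + t • blk g := by
        ext x
        simp only [blk, LinearMap.comp_apply, LinearMap.add_apply, LinearMap.smul_apply, map_add]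
        rw [LinearMap.map_smul_of_tower]
      rw [← hadd, rk_eq_finrank_range_restrictScalars, rk_eq_finrank_range_restrictScalars,
        LinearMap.finrank_range_of_inj (f := (blk f).restrictScalars K) hbf] at ht₁
      have hrn := ((blk (f + t • g)).restrictScalars K).finrank_range_add_finrank_ker
      exact LinearMap.ker_eq_bot (f := (blk (f + t • g)).restrictScalars K).mp
        (Submodule.finrank_eq_zero.mp (by omega))
    have hk₂ : Function.Surjective (act (f + t • g)) := by
      have hadd : act (f + t • g) = act f + t • act g :=
        LinearMap.ext fun u => LinearMap.ext fun x => rfl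
      rw [← hadd, LinearMap.range_eq_top.mpr hactf, finrank_top] at ht₂
      exact LinearMap.range_eq_top.mp
        (Submodule.eq_top_of_finrank_eq ((Submodule.finrank_le _).antisymm ht₂))
    have hk₃ : rk K g ≤ rk K (f + t • g) := by
      have hs : f + t • g = t • (g + t⁻¹ • f) := by
        rw [smul_add, smul_smul, mul_inv_cancel₀ ht0, one_smul, add_comm]
      rw [hs, rk_smul ht0]
      by_contra! hlt
      exact ht₃ ⟨t⁻¹, hlt, inv_inv t⟩
    have hk₄ : LinearMap.range (f + t • g) ≤ (Q₁ ⊔ R).map (f + t • g) := by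
      rw [LinearMap.range_eq_map, ← h₃, Submodule.map_sup, sup_le_iff]
      refine ⟨le_rfl, ?_⟩
      rintro _ ⟨q, hq, rfl⟩
      obtain ⟨u, hu⟩ := hk₂ ((f + t • g) ∘ₗ Q.subtype)
      exact ⟨u ⟨q, hq⟩, (u ⟨q, hq⟩).2, LinearMap.congr_fun hu ⟨q, hq⟩⟩
    have h5 := finrank_map_sup_le hc₀ e hk₁ (K := K) (Q₁ := Q₁)
    have h6 : rk K (f + t • g) ≤ Module.finrank K ((Q₁ ⊔ R).map (f + t • g)) :=
      finrank_le_finrank_of_le_of_isScalarTower (K := K) hk₄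
    omega
end
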